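/- Let (π, Y, X) be a ℂ̂-bundle and f : Y → Y a fibered rational map over g : X → X with d(x) ≥ 2 for each x ∈ X. Then for each x ∈ X there exists a Borel probability measure μ_x on Y satisfying: (1) x ↦ μ_x is continuous with respect to the weak topology on probability measures on Y; (2) supp(μ_x) = J_x for each x ∈ X; and (3) x ↦ J_x is lower semicontinuous with respect to the Hausdorff metric on non-empty compact subsets of Y, i.e. if x_n → x in X and y ∈ J_x, then there exist y_n ∈ J_{x_n} with y_n → y. Furthermore, J_x(f) is a non-empty perfect set for each x ∈ X. -/

import Mathlib

open Set Metric Topology Filter MeasureTheory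

noncomputable section

/-- The Riemann sphere `ℂ̂`, as a type synonym of the one-point compactification
`Option ℂ = OnePoint ℂ` of `ℂ`, equipped below with the spherical metric
(induced by a stereographic-type embedding into `ℂ × ℝ`). -/
def CSphere : Type := Option ℂ

namespace CSphere

/-- The point at infinity of the Riemann sphere. -/
def infty : CSphere := (none : Option ℂ)

/-- The inclusion of `ℂ` into the Riemann sphere. -/
def ofC (z : ℂ) : CSphere := (some z : Option ℂ)

/-- A stereographic-type embedding of the Riemann sphere into `ℂ × ℝ`,
used to induce the spherical metric. -/
def embed (z : CSphere) : ℂ × ℝ :=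
  Option.rec ((0 : ℂ), (1 : ℝ))
    (fun w => ((2 / (1 + ‖w‖ ^ 2)) • w, (‖w‖ ^ 2 - 1) / (‖w‖ ^ 2 + 1))) z

@[simp] lemma embed_infty : embed infty = ((0 : ℂ), (1 : ℝ)) := rfl

@[simp] lemma embed_ofC (w : ℂ) :
    embed (ofC w) = (((2 / (1 + ‖w‖ ^ 2)) • w : ℂ), (‖w‖ ^ 2 - 1) / (‖w‖ ^ 2 + 1)) := rfl

lemma cases' (z : CSphere) : z = infty ∨ ∃ w : ℂ, z = ofC w :=
  Option.rec (Or.inl rfl) (fun w => Or.inr ⟨w, rfl⟩) z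

lemma embed_inj : Function.Injective embed := by
  intro a b h
  rcases cases' a with rfl | ⟨v, rfl⟩ <;> rcases cases' b with rfl | ⟨w, rfl⟩
  · rfl
  · exfalso
    have h2 := congrArg Prod.snd h
    simp only [embed_infty, embed_ofC] at h2
    have hw : (0:ℝ) < ‖w‖ ^ 2 + 1 := by positivity
    rw [eq_div_iff (by nlinarith : (‖w‖ ^ 2 + 1 : ℝ) ≠ 0)] at h2
    nlinarith
  · exfalso
    have h2 := congrArg Prod.snd h
    simp only [embed_infty, embed_ofC] at h2
    have hv : (0:ℝ) < ‖v‖ ^ 2 + 1 := by positivity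
    rw [div_eq_iff (by nlinarith : (‖v‖ ^ 2 + 1 : ℝ) ≠ 0)] at h2
    nlinarith
  · have h2 := congrArg Prod.snd h
    simp only [embed_ofC] at h2
    have hv : (0:ℝ) < ‖v‖ ^ 2 + 1 := by positivity
    have hw : (0:ℝ) < ‖w‖ ^ 2 + 1 := by positivity
    have hnorm : ‖v‖ ^ 2 = ‖w‖ ^ 2 := by
      rw [div_eq_div_iff (by nlinarith : (‖v‖ ^ 2 + 1 : ℝ) ≠ 0)
        (by nlinarith : (‖w‖ ^ 2 + 1 : ℝ) ≠ 0)] at h2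
      nlinarith
    have h1 := congrArg Prod.fst h
    simp only [embed_ofC, hnorm] at h1
    have hc : (2 / (1 + ‖w‖ ^ 2) : ℝ) ≠ 0 := by positivity
    exact congrArg ofC (smul_right_injective ℂ hc h1)

/-- The spherical metric on the Riemann sphere. -/
instance : MetricSpace CSphere := MetricSpace.induced embed embed_inj inferInstance

instance : MeasurableSpace CSphere := borel CSphere

instance : BorelSpace CSphere := ⟨rfl⟩

/-- The self-map of the Riemann sphere induced by a pair of polynomials `p, q`,
i.e. the rational map `z ↦ p(z)/q(z)`. -/
def ratLift (p q : Polynomial ℂ) (z : CSphere) : CSphere :=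
  Option.rec
    (if q.natDegree < p.natDegree then infty
     else if p.natDegree < q.natDegree then ofC 0
     else ofC (p.leadingCoeff / q.leadingCoeff))
    (fun w => if q.eval w = 0 then infty else ofC (p.eval w / q.eval w)) z

/-- `φ` is the rational map on the Riemann sphere determined by the coprime
pair of polynomials `(p, q)` with `q ≠ 0`. -/
def IsRatPair (p q : Polynomial ℂ) (φ : CSphere → CSphere) : Prop :=
  q ≠ 0 ∧ IsCoprime p q ∧ φ = ratLift p q

/-- `φ` is a rational map of degree `n` on the Riemann sphere. -/
def ratDegEq (φ : CSphere → CSphere) (n : ℕ) : Prop :=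
  ∃ p q : Polynomial ℂ, IsRatPair p q φ ∧ max p.natDegree q.natDegree = n

/-- `φ` is a rational map on the Riemann sphere (constants allowed). -/
def IsRatMap (φ : CSphere → CSphere) : Prop := ∃ n, ratDegEq φ n

/-- `φ` is a Möbius transformation of the Riemann sphere. -/
def IsMobius (φ : CSphere → CSphere) : Prop := ratDegEq φ 1

/-- `φ` is a non-constant rational map on the Riemann sphere. -/
def IsNonconstRatMap (φ : CSphere → CSphere) : Prop := ∃ n, 1 ≤ n ∧ ratDegEq φ n

/-- `φ` is a rational map of degree at least two. -/
def IsRatMapDegGeTwo (φ : CSphere → CSphere) : Prop := ∃ n, 2 ≤ n ∧ ratDegEq φ n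

end CSphere

/-- For a proper holomorphic map `g : V → B`, "`deg (g : V → B) ≤ N`":
every point of `B` has at most `N` preimages in `V`.  (For proper holomorphic
maps this is equivalent to the degree, counted with multiplicity, being `≤ N`,
since a generic point has `deg` distinct preimages.) -/
def degLe {α β : Type*} (gmap : α → β) (V : Set α) (B : Set β) (N : ℕ) : Prop :=
  ∀ w ∈ B, (V ∩ gmap ⁻¹' {w}).ncard ≤ N

/-- `K` is `C`-uniformly perfect: `K` has at least two points, and every round
annulus `{z | r < dist a z < R}` disjoint from `K` which separates `K`
has modulus `log (R/r) / (2π) < C`.  (By Teichmüller's theorem this round-annulus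
formulation is equivalent to the formulation with arbitrary separating ring domains.) -/
def UnifPerfect {α : Type*} [MetricSpace α] (K : Set α) (C : ℝ) : Prop :=
  K.Nontrivial ∧ ∀ (a : α) (r R : ℝ), 0 < r → r < R →
    (∀ z ∈ K, dist a z ≤ r ∨ R ≤ dist a z) →
    (K ∩ {z | dist a z ≤ r}).Nonempty →
    (K ∩ {z | R ≤ dist a z}).Nonempty →
    Real.log (R / r) < 2 * Real.pi * C

/-- `J` is `k`-porous: every ball `B(x,r)` centred on `J` contains a ball of
radius `k r` disjoint from `J`. -/
def kPorous {α : Type*} [MetricSpace α] (J : Set α) (k : ℝ) : Prop :=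
  ∀ x ∈ J, ∀ r > (0:ℝ), ∃ y, Metric.ball y (k * r) ⊆ Metric.ball x r \ J

/-- `J` is `k`-porous inside the subspace `A`: for every `x ∈ J` and `r > 0`
there is a relative ball in `A` of radius `k r` inside `B(x,r) ∩ A` missing `J`. -/
def kPorousIn {α : Type*} [MetricSpace α] (A J : Set α) (k : ℝ) : Prop :=
  ∀ x ∈ J, ∀ r > (0:ℝ), ∃ y ∈ A, A ∩ Metric.ball y (k * r) ⊆ (A ∩ Metric.ball x r) \ J

/-- Minimal number of balls of radius `r` needed to cover `s`. -/
def coverNum {α : Type*} [MetricSpace α] (s : Set α) (r : ℝ) : ℕ∞ :=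
  sInf {n : ℕ∞ | ∃ t : Finset α, (t.card : ℕ∞) = n ∧ s ⊆ ⋃ y ∈ t, Metric.ball y r}

/-- The upper box (Minkowski) dimension of a (bounded) set. -/
def upperBoxDim {α : Type*} [MetricSpace α] (s : Set α) : ℝ :=
  Filter.limsup (fun r : ℝ => Real.log ((coverNum s r).toNat : ℝ) / Real.log (1 / r))
    (𝓝[>] (0:ℝ))

/-- The norm of the derivative of `φ` at `z` with respect to the metrics of the
source and target (for a holomorphic map between spheres with their spherical
metrics, this is the usual spherical derivative `‖φ′(z)‖`). -/
def sphDeriv {α β : Type*} [MetricSpace α] [MetricSpace β] (φ : α → β) (z : α) : ℝ :=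
  Filter.limsup (fun w => dist (φ w) (φ z) / dist w z) (𝓝[≠] z)

/-- The derivative of `φ` along `S` vanishes at `z` (i.e. `z` is a critical point
with `φ′(z) = 0`, expressed metrically). -/
def critPtOn {α β : Type*} [MetricSpace α] [MetricSpace β] (φ : α → β) (S : Set α)
    (z : α) : Prop :=
  Filter.Tendsto (fun w => dist (φ w) (φ z) / dist w z) (𝓝[S \ {z}] z) (𝓝 0)

end
noncomputable section

open Set Metric Topology Filter MeasureTheory

variable {X Y : Type*}

/-- A local trivialization of a `ℂ̂`-bundle `proj : Y → X` over the set `U ⊆ X`: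
a fibre-preserving homeomorphism `U × ℂ̂ ≃ proj⁻¹(U)`. -/
structure CSphereTriv [TopologicalSpace X] [TopologicalSpace Y]
    (proj : Y → X) (U : Set X) where
  equiv : (↥U × CSphere) ≃ₜ ↥(proj ⁻¹' U)
  fiber_eq : ∀ (u : ↥U) (z : CSphere), proj (equiv (u, z) : Y) = (u : X)

namespace CSphereTriv

variable [TopologicalSpace X] [TopologicalSpace Y] {proj : Y → X} {U : Set X}

/-- The local parameterization `i_x : ℂ̂ → Y_x` of the fibre over `x ∈ U`. -/
def param (T : CSphereTriv proj U) (x : X) (hx : x ∈ U) (z : CSphere) : Y :=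
  (T.equiv (⟨x, hx⟩, z) : Y)

@[simp] lemma proj_param (T : CSphereTriv proj U) (x : X) (hx : x ∈ U) (z : CSphere) :
    proj (T.param x hx z) = x :=
  T.fiber_eq ⟨x, hx⟩ z

/-- The `ℂ̂`-coordinate `i_x⁻¹(y)` of a point `y` lying over `U`. -/
def coord (T : CSphereTriv proj U) (y : Y) (hy : proj y ∈ U) : CSphere :=
  (T.equiv.symm ⟨y, hy⟩).2

end CSphereTriv

/-- The data of a `ℂ̂`-bundle `(π, Y, X)` (with an atlas of fibrewise
trivializations) together with a fibre-preserving continuous map `f : Y → Y`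
over a continuous map `g : X → X`.  (The rationality/Möbius conditions are
imposed in the structure `FRM` below.)  The distance on each fibre `Y_x` is the
one induced from the ambient metric space `Y`. -/
structure PreFRM (X Y : Type*) [MetricSpace X] [MetricSpace Y] where
  proj : Y → X
  g : X → X
  f : Y → Y
  proj_cont : Continuous proj
  proj_surj : Function.Surjective proj
  g_cont : Continuous g
  f_cont : Continuous f
  semiconj : ∀ y, proj (f y) = g (proj y)
  ι : Type
  U : ι → Set X
  U_open : ∀ i, IsOpen (U i)
  U_cover : ∀ x, ∃ i, x ∈ U i
  triv : ∀ i, CSphereTriv proj (U i)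

namespace PreFRM

variable [MetricSpace X] [MetricSpace Y] (F : PreFRM X Y)

/-- The fibre `Y_x = π⁻¹{x}`. -/
def fiber (x : X) : Set Y := F.proj ⁻¹' {x}

/-- The transition map between two trivializations at `x` (required to be Möbius). -/
def conjTrans (i j : F.ι) (x : X) (hi : x ∈ F.U i) (hj : x ∈ F.U j) :
    CSphere → CSphere :=
  fun z => (F.triv j).coord ((F.triv i).param x hi z)
    (by rw [(F.triv i).proj_param x hi z]; exact hj)

/-- The fibre map `f_x : Y_x → Y_{g(x)}` read in local coordinates
(required to be a rational map). -/
def conjMap (i j : F.ι) (x : X) (hi : x ∈ F.U i) (hj : F.g x ∈ F.U j) :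
    CSphere → CSphere :=
  fun z => (F.triv j).coord (F.f ((F.triv i).param x hi z))
    (by rw [F.semiconj, (F.triv i).proj_param x hi z]; exact hj)

/-- `d(x) = deg (f_x) ≥ n`. -/
def degGe (x : X) (n : ℕ) : Prop :=
  ∃ (i j : F.ι) (hi : x ∈ F.U i) (hj : F.g x ∈ F.U j) (p q : Polynomial ℂ),
    CSphere.IsRatPair p q (F.conjMap i j x hi hj) ∧ n ≤ max p.natDegree q.natDegree

/-- The fibrewise Fatou set `F_x`: points of `Y_x` having a relative
neighbourhood in `Y_x` on which the family of iterates `{f_x^n}` is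
(locally, uniformly) equicontinuous — equivalently, normal. -/
def fatou (x : X) : Set Y :=
  {y | F.proj y = x ∧ ∃ r > (0:ℝ), ∀ ε > (0:ℝ), ∃ δ > (0:ℝ), ∀ n : ℕ,
    ∀ y₁ ∈ F.fiber x ∩ ball y r, ∀ y₂ ∈ F.fiber x ∩ ball y r,
      dist y₁ y₂ < δ → dist (F.f^[n] y₁) (F.f^[n] y₂) < ε}

/-- The fibrewise Julia set `J_x = Y_x \ F_x`. -/
def julia (x : X) : Set Y := F.fiber x \ F.fatou x

/-- `J̃(f)`, the closure in `Y` of the union of the fibrewise Julia sets. -/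
def Jtilde : Set Y := closure (⋃ x : X, F.julia x)

/-- `F̃(f) = Y \ J̃(f)`. -/
def Ftilde : Set Y := (F.Jtilde)ᶜ

/-- `Ĵ_x = J̃(f) ∩ Y_x`. -/
def Jhat (x : X) : Set Y := F.Jtilde ∩ F.fiber x

/-- The ball `i_x(B(c, δ)) ⊆ Y_x` in the fibre over `x`, for the trivialization `i`. -/
def trBall (i : F.ι) (x : X) (hx : x ∈ F.U i) (c : CSphere) (δ : ℝ) : Set Y :=
  (fun z => (F.triv i).param x hx z) '' ball c δ

/-- `SH_N(f)`: the set of semi-hyperbolic points of degree `N` of a fibered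
rational map. -/
def SHN (N : ℕ) : Set Y :=
  {z | ∃ δ > (0:ℝ), ∃ (i : F.ι) (hz : F.proj z ∈ F.U i),
    ∀ (x : X) (hx : x ∈ F.U i) (n : ℕ) (xn : X), F.g^[n] xn = x →
      ∀ y : Y, F.proj y = xn →
        F.f^[n] y ∈ F.trBall i x hx ((F.triv i).coord z hz) δ →
        degLe (F.f^[n])
          (connectedComponentIn
            (F.fiber xn ∩ F.f^[n] ⁻¹' F.trBall i x hx ((F.triv i).coord z hz) δ) y)
          (F.trBall i x hx ((F.triv i).coord z hz) δ) N}

/-- `UH(f) = Y \ ⋃_N SH_N(f)`. -/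
def UH : Set Y := (⋃ N : ℕ, F.SHN N)ᶜ

/-- `f` is semi-hyperbolic (along fibres). -/
def SemiHyp : Prop := F.Jtilde ⊆ ⋃ N : ℕ, F.SHN N

/-- Condition (C1). -/
def C1 : Prop :=
  ∃ (c : X → Y) (r : X → ℝ),
    (∀ x, F.proj (c x) = x) ∧ (∀ x, 0 < r x) ∧ (∃ ε > (0:ℝ), ∀ x, ε ≤ r x) ∧
    closure (⋃ (x : X) (n : ℕ), F.f^[n] '' (F.fiber x ∩ ball (c x) (r x))) ⊆ F.Ftilde ∧
    ∀ x, Tendsto (fun n : ℕ => Metric.diam (F.f^[n] '' (F.fiber x ∩ ball (c x) (r x))))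
      atTop (𝓝 0)

/-- The set of good points `J̃_good(f)`. -/
def Jgood : Set Y :=
  {z | z ∈ F.Jtilde ∧
    0 < Filter.limsup (fun n : ℕ => Metric.infDist (F.f^[n] z) F.UH) atTop}

/-- The ball `B̃(y, r)` of radius `r` about `y` inside the fibre `Y_{π(y)}`. -/
def fball (y : Y) (r : ℝ) : Set Y := F.fiber (F.proj y) ∩ ball y r

/-- The conical set `J̃_con(f)`. -/
def Jcon : Set Y :=
  {z | z ∈ F.Jtilde ∧ ∃ (N : ℕ) (r : ℝ), 0 < r ∧ ∀ ε > (0:ℝ), ∃ n : ℕ,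
    Metric.diam (connectedComponentIn
        (F.fiber (F.proj z) ∩ F.f^[n] ⁻¹' F.fball (F.f^[n] z) r) z) ≤ ε ∧
    SimplyConnectedSpace ↥(connectedComponentIn
        (F.fiber (F.proj z) ∩ F.f^[n] ⁻¹' F.fball (F.f^[n] z) r) z) ∧
    degLe (F.f^[n])
      (connectedComponentIn
        (F.fiber (F.proj z) ∩ F.f^[n] ⁻¹' F.fball (F.f^[n] z) r) z)
      (F.fball (F.f^[n] z) r) N}

/-- The derivative of `f_{π(z)}^n` (the restriction of `f^n` to the fibre of `z`)
vanishes at `z`. -/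
def fiberCritAt (n : ℕ) (z : Y) : Prop :=
  Filter.Tendsto (fun w => dist (F.f^[n] w) (F.f^[n] z) / dist w z)
    (𝓝[F.fiber (F.proj z) \ {z}] z) (𝓝 0)

end PreFRM

/-- A fibered rational map `f : Y → Y` over `g : X → X` on a `ℂ̂`-bundle
`(π, Y, X)`: the transitions of the atlas are Möbius and all fibre maps
`f_x : Y_x → Y_{g(x)}` are rational in local coordinates. -/
structure FRM (X Y : Type*) [MetricSpace X] [MetricSpace Y] extends PreFRM X Y where
  mobius : ∀ (i j : toPreFRM.ι) (x : X) (hi : x ∈ toPreFRM.U i)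
    (hj : x ∈ toPreFRM.U j), CSphere.IsMobius (toPreFRM.conjTrans i j x hi hj)
  rational : ∀ (i j : toPreFRM.ι) (x : X) (hi : x ∈ toPreFRM.U i)
    (hj : toPreFRM.g x ∈ toPreFRM.U j), CSphere.IsRatMap (toPreFRM.conjMap i j x hi hj)

/-- The relative frontier of `B` inside the (closed) subspace `K`: the boundary
of `B ∩ K` with respect to the subspace topology of `K`. -/
def relFrontier [MetricSpace Y] (K B : Set Y) : Set Y :=
  K ∩ closure B ∩ closure (K \ B)

end

namespace FJ
open InnerProductSpace

/-- Borel-Caratheodory centred at `c`. -/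
lemma bc_center {f : ℂ → ℂ} {c : ℂ} {R M : ℝ} (hR : 0 < R) (hM : 0 < M)
    (hf : DifferentiableOn ℂ f (ball c R)) (hre : ∀ z ∈ ball c R, (f z).re ≤ M) (h0 : f c = 0)
    {z : ℂ} (hz : z ∈ ball c (R / 2)) : ‖f z‖ ≤ 2 * M := by
  have hz' : ‖z - c‖ < R / 2 := by simpa [dist_eq_norm] using hz
  have key := Complex.borelCaratheodory_zero (f := fun w => f (c + w)) (M := M) (R := R)
    (z := z - c) hM ?_ ?_ hR ?_ ?_
  · simp only [add_sub_cancel] at key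
    refine key.trans ?_
    rw [div_le_iff₀ (by linarith)]
    nlinarith
  · refine hf.comp (by fun_prop) ?_
    intro w hw
    simpa [dist_eq_norm] using hw
  · intro w hw
    exact hre _ (by simpa [dist_eq_norm] using hw)
  · simp only [mem_ball, dist_zero_right]; linarith
  · simpa using h0

lemma harnack {h : ℂ → ℂ} {c p z : ℂ} {r η : ℝ} (hη : 0 < η)
    (hd : DifferentiableOn ℂ h (ball c r)) (hpos : ∀ w ∈ ball c r, 0 ≤ (h w).re)
    (hp : p ∈ ball c (r / 4)) (hz : z ∈ ball c (r / 8)) (hpη : (h p).re ≤ η) :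
    (h z).re ≤ 3 * η := by
  have hr : 0 < r := by have := pos_of_mem_ball hz; linarith
  have hp' : dist p c < r / 4 := hp
  have hz' : dist z c < r / 8 := hz
  have hsub : ball p (3 * r / 4) ⊆ ball c r := by
    intro w hw
    have : dist w p < 3 * r / 4 := hw
    have := dist_triangle w p c
    simp only [mem_ball]; linarith
  have := bc_center (f := fun w => h p - h w) (c := p) (R := 3 * r / 4) (M := η) (by linarith) hη
    ((differentiableOn_const _).sub (hd.mono hsub))
    (fun w hw => by
      have := hpos w (hsub hw)
      simp only [Complex.sub_re]; linarith) (by simp) (z := z)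
    (by
      have := dist_triangle z c p
      rw [dist_comm c p] at this
      simp only [mem_ball]; linarith)
  have h2 := (Complex.abs_re_le_norm _).trans this
  rw [abs_le] at h2
  simp only [Complex.sub_re] at h2
  linarith [h2.1]

lemma harnack_almost {h : ℂ → ℂ} {u : ℂ → ℝ} {c p z : ℂ} {r η ε : ℝ} (hη : 0 < η) (hε : 0 < ε)
    (hd : DifferentiableOn ℂ h (ball c r)) (hu : ∀ w ∈ ball c r, |u w - (h w).re| ≤ ε)
    (hpos : ∀ w, 0 ≤ u w)
    (hp : p ∈ ball c (r / 4)) (hz : z ∈ ball c (r / 8)) (hpη : u p ≤ η) :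
    u z ≤ 3 * η + 6 * ε := by
  have hr : 0 < r := by have := pos_of_mem_ball hz; linarith
  have h1 := hu p (ball_subset_ball (by linarith) hp)
  have h2 := hu z (ball_subset_ball (by linarith) hz)
  rw [abs_le] at h1 h2
  have := harnack (h := fun w => h w + (ε : ℂ)) (c := c) (p := p) (z := z) (r := r)
    (η := η + 2 * ε) (by linarith) (hd.add_const _)
    (fun w hw => by
      have h3 := hu w hw
      rw [abs_le] at h3
      have := hpos w
      simp only [Complex.add_re, Complex.ofReal_re]; linarith) hp hz
    (by simp only [Complex.add_re, Complex.ofReal_re]; linarith)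
  simp only [Complex.add_re, Complex.ofReal_re] at this
  linarith

/-- The functions `u k` are, near each point, asymptotically real parts of holomorphic functions. -/
def AlmostHarm {α : Type*} (l : Filter α) (u : α → ℂ → ℝ) : Prop :=
  ∀ z₀ : ℂ, ∃ r > (0 : ℝ), ∀ ε > (0 : ℝ), ∀ᶠ k in l, ∃ h : ℂ → ℂ,
    DifferentiableOn ℂ h (ball z₀ r) ∧ ∀ z ∈ ball z₀ r, |u k z - (h z).re| ≤ ε

lemma AlmostHarm.neg {α : Type*} {l : Filter α} {u : α → ℂ → ℝ} (h : AlmostHarm l u) :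
    AlmostHarm l (fun k z => - u k z) := by
  intro z₀
  obtain ⟨r, hr, H⟩ := h z₀
  refine ⟨r, hr, fun ε hε => (H ε hε).mono ?_⟩
  rintro k ⟨h, hd, hh⟩
  refine ⟨fun z => - h z, hd.neg, fun z hz => ?_⟩
  have := hh z hz
  rw [← abs_neg] at this
  convert this using 2
  simp; ring

lemma AlmostHarm.sub_const {α : Type*} {l : Filter α} {u : α → ℂ → ℝ} (h : AlmostHarm l u)
    (c : α → ℝ) : AlmostHarm l (fun k z => u k z - c k) := by
  intro z₀
  obtain ⟨r, hr, H⟩ := h z₀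
  refine ⟨r, hr, fun ε hε => (H ε hε).mono ?_⟩
  rintro k ⟨h, hd, hh⟩
  refine ⟨fun z => h z - (c k : ℂ), hd.sub_const _, fun z hz => ?_⟩
  have := hh z hz
  convert this using 2
  simp

lemma AlmostHarm.mono {α : Type*} {l l' : Filter α} {u : α → ℂ → ℝ} (h : AlmostHarm l u)
    (hl : l' ≤ l) : AlmostHarm l' u := by
  intro z₀
  obtain ⟨r, hr, H⟩ := h z₀
  exact ⟨r, hr, fun ε hε => (H ε hε).filter_mono hl⟩

lemma chain_local {α : Type*} {l : Filter α} {u : α → ℂ → ℝ} (hpos : ∀ᶠ k in l, ∀ z, 0 ≤ u k z)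
    (hloc : AlmostHarm l u) {a : α → ℂ} {a₀ : ℂ} (ha : Tendsto a l (𝓝 a₀))
    (hu : ∀ ε > (0:ℝ), ∀ᶠ k in l, u k (a k) ≤ ε) (z₀ : ℂ) :
    ∃ s > (0 : ℝ), ∀ ε > (0 : ℝ), ∀ᶠ k in l, ∀ z ∈ ball z₀ s, u k z ≤ ε := by
  set A : Set ℂ := {z₀ | ∃ s > (0 : ℝ), ∀ ε > (0 : ℝ), ∀ᶠ k in l, ∀ z ∈ ball z₀ s, u k z ≤ ε}
  have step : ∀ z₀ : ℂ, ∃ r > (0 : ℝ), ∀ b : α → ℂ, (∀ᶠ k in l, b k ∈ ball z₀ r) →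
      (∀ ε > (0:ℝ), ∀ᶠ k in l, u k (b k) ≤ ε) → z₀ ∈ A := by
    intro z₀
    obtain ⟨r, hr, H⟩ := hloc z₀
    refine ⟨r / 4, by linarith, fun b hb hub => ⟨r / 8, by linarith, fun ε hε => ?_⟩⟩
    filter_upwards [hpos, H (ε / 12) (by linarith), hb, hub (ε / 6) (by linarith)]
      with k h1 h2 h3 h4 z hz
    obtain ⟨h, hd, hh⟩ := h2
    have := harnack_almost (by linarith) (by linarith) hd hh h1 h3 hz h4
    linarith
  have hopen : IsOpen A := by
    rw [Metric.isOpen_iff]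
    rintro z ⟨s, hs, H⟩
    refine ⟨s / 2, by linarith, fun w hw => ⟨s / 2, by linarith, fun ε hε => (H ε hε).mono ?_⟩⟩
    intro k hk x hx
    refine hk x ?_
    have h1 : dist w z < s / 2 := hw
    have h2 : dist x w < s / 2 := hx
    have := dist_triangle x w z
    simp only [mem_ball]; linarith
  have hclosed : IsClosed A := by
    rw [← closure_subset_iff_isClosed]
    intro z hz
    obtain ⟨r, hr, H⟩ := step z
    obtain ⟨w, hw, hwr⟩ := Metric.mem_closure_iff.1 hz r hr
    obtain ⟨s, hs, hsw⟩ := hw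
    refine H (fun _ => w) (Eventually.of_forall fun _ => by rw [mem_ball, dist_comm]; exact hwr) ?_
    intro ε hε
    exact (hsw ε hε).mono fun k hk => hk w (mem_ball_self hs)
  have hne : A.Nonempty := by
    obtain ⟨r, hr, H⟩ := step a₀
    exact ⟨a₀, H a (ha (ball_mem_nhds _ hr)) hu⟩
  have : A = univ := IsClopen.eq_univ ⟨hclosed, hopen⟩ hne
  have h : z₀ ∈ A := by rw [this]; exact mem_univ _
  exact h

lemma chain {α : Type*} {l : Filter α} {u : α → ℂ → ℝ} (hpos : ∀ᶠ k in l, ∀ z, 0 ≤ u k z)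
    (hloc : AlmostHarm l u) {a : α → ℂ} {a₀ : ℂ} (ha : Tendsto a l (𝓝 a₀))
    (hu : ∀ ε > (0:ℝ), ∀ᶠ k in l, u k (a k) ≤ ε) {K : Set ℂ} (hK : IsCompact K) {ε : ℝ}
    (hε : 0 < ε) : ∀ᶠ k in l, ∀ z ∈ K, u k z ≤ ε := by
  refine hK.induction_on (p := fun s => ∀ᶠ k in l, ∀ z ∈ s, u k z ≤ ε) (by simp) ?_ ?_ ?_
  · intro s t hst ht
    exact ht.mono fun k hk z hz => hk z (hst hz)
  · intro s t hs ht
    filter_upwards [hs, ht] with k h1 h2 z hz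
    exact hz.elim (h1 z) (h2 z)
  · intro z _
    obtain ⟨s, hs, H⟩ := chain_local hpos hloc ha hu z
    exact ⟨ball z s, mem_nhdsWithin_of_mem_nhds (ball_mem_nhds _ hs), H ε hε⟩

lemma harm_re {F : ℂ → ℂ} {c : ℂ} {r : ℝ} (hF : DifferentiableOn ℂ F (ball c r)) :
    HarmonicOnNhd (fun z => (F z).re) (ball c r) :=
  fun _ hz => AnalyticAt.harmonicAt_re (hF.analyticAt (isOpen_ball.mem_nhds hz))

lemma harm_congr {u v : ℂ → ℝ} {s : Set ℂ} (hs : IsOpen s) (hu : HarmonicOnNhd u s)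
    (h : ∀ z ∈ s, v z = u z) : HarmonicOnNhd v s := by
  intro z hz
  refine (harmonicAt_congr_nhds ?_).2 (hu z hz)
  filter_upwards [hs.mem_nhds hz] with w hw using h w hw

/-- A locally uniform limit of harmonic functions is harmonic. -/
lemma harm_limit {u : ℂ → ℝ} {c : ℂ} {r : ℝ} (hr : 0 < r)
    (H : ∀ ε > (0 : ℝ), ∃ h : ℂ → ℝ, HarmonicOnNhd h (ball c r) ∧
      ∀ z ∈ ball c r, |u z - h z| ≤ ε) : HarmonicOnNhd u (ball c (r / 2)) := by
  have H' : ∀ n : ℕ, ∃ F : ℂ → ℂ, DifferentiableOn ℂ F (ball c r) ∧ (F c).im = 0 ∧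
      ∀ z ∈ ball c r, |u z - (F z).re| ≤ 1 / ((n : ℝ) + 1) := by
    intro n
    obtain ⟨h, hh, hu⟩ := H (1 / ((n : ℝ) + 1)) (by positivity)
    obtain ⟨F, hF, hFe⟩ := hh.exists_analyticOnNhd_ball_re_eq
    refine ⟨fun z => F z - ((F c).im : ℂ) * Complex.I,
      (hF.differentiableOn).sub_const _, by simp, fun z hz => ?_⟩
    have h1 := hu z hz
    have h2 : (F z).re = h z := hFe hz
    rw [← h2] at h1
    simpa using h1
  choose F hFd hFim hFu using H'
  have cau : ∀ m n : ℕ, ∀ z ∈ ball c (r / 2), ‖F m z - F n z‖ ≤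
      7 * (1 / ((m : ℝ) + 1) + 1 / ((n : ℝ) + 1)) := by
    intro m n z hz
    set M := 1 / ((m : ℝ) + 1) + 1 / ((n : ℝ) + 1) with hM
    have hMpos : 0 < M := by positivity
    have hre : ∀ w ∈ ball c r, |(F m w).re - (F n w).re| ≤ M := by
      intro w hw
      have h1 := hFu m w hw
      have h2 := hFu n w hw
      rw [abs_le] at *
      constructor <;> linarith [h1.1, h1.2, h2.1, h2.2]
    have hcc := hre c (mem_ball_self hr)
    have hc' : F m c - F n c = (((F m c).re - (F n c).re : ℝ) : ℂ) := by
      apply Complex.ext <;> simp [hFim]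
    have hnc : ‖F m c - F n c‖ ≤ M := by
      rw [hc', Complex.norm_real]; exact hcc
    have := bc_center (f := fun w => (F m w - F n w) - (F m c - F n c)) (c := c) (R := r)
      (M := 2 * M) hr (by linarith) (((hFd m).sub (hFd n)).sub_const _)
      (fun w hw => by
        have h1 := hre w hw
        rw [abs_le] at h1 hcc
        simp only [Complex.sub_re]; linarith [h1.2, hcc.1]) (by simp) hz
    calc ‖F m z - F n z‖ = ‖((F m z - F n z) - (F m c - F n c)) + (F m c - F n c)‖ := by ring_nf
      _ ≤ 2 * (2 * M) + M := (norm_add_le _ _).trans (add_le_add this hnc)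
      _ ≤ 7 * M := by linarith
  have t0 : Tendsto (fun n : ℕ => 1 / ((n : ℝ) + 1)) atTop (𝓝 0) :=
    tendsto_one_div_add_atTop_nhds_zero_nat
  have hucs : UniformCauchySeqOn F atTop (ball c (r / 2)) := by
    rw [Metric.uniformCauchySeqOn_iff]
    intro ε hε
    obtain ⟨N, hN⟩ := eventually_atTop.1 (t0.eventually (gt_mem_nhds (show (0:ℝ) < ε / 14 by linarith)))
    refine ⟨N, fun m hm n hn z hz => ?_⟩
    rw [dist_eq_norm]
    have h1 := hN m hm
    have h2 := hN n hn
    refine (cau m n z hz).trans_lt ?_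
    linarith
  have hlim : ∀ z ∈ ball c (r / 2), ∃ y, Tendsto (fun n => F n z) atTop (𝓝 y) := by
    intro z hz
    exact cauchySeq_tendsto_of_complete (hucs.cauchySeq hz)
  choose! G hG using hlim
  have hunif := hucs.tendstoUniformlyOn_of_tendsto hG
  have hGd : DifferentiableOn ℂ G (ball c (r / 2)) :=
    hunif.tendstoLocallyUniformlyOn.differentiableOn
      (Eventually.of_forall fun n => (hFd n).mono (ball_subset_ball (by linarith))) isOpen_ball
  refine harm_congr isOpen_ball (harm_re hGd) ?_
  intro z hz
  have h1 : Tendsto (fun n => (F n z).re) atTop (𝓝 (G z).re) :=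
    (Complex.continuous_re.tendsto _).comp (hG z hz)
  have h2 : Tendsto (fun n => (F n z).re) atTop (𝓝 (u z)) := by
    rw [tendsto_iff_dist_tendsto_zero]
    refine squeeze_zero (fun _ => dist_nonneg) (fun n => ?_) t0
    rw [dist_comm, Real.dist_eq]
    exact hFu n z (ball_subset_ball (by linarith) hz)
  exact tendsto_nhds_unique h2 h1

lemma fderiv_re {F : ℂ → ℂ} {z k : ℂ} {u : ℂ → ℝ} (hF : HasDerivAt F k z)
    (hu : u =ᶠ[𝓝 z] fun w => (F w).re) :
    HasFDerivAt u (Complex.reCLM ∘L ((k • (ContinuousLinearMap.id ℝ ℂ)) : ℂ →L[ℝ] ℂ)) z := by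
  have h1 : HasFDerivAt F ((k • (ContinuousLinearMap.id ℝ ℂ)) : ℂ →L[ℝ] ℂ) z := by
    exact hF.complexToReal_fderiv
  exact (Complex.reCLM.hasFDerivAt.comp z h1).congr_of_eventuallyEq hu

/-- Removable singularities for continuous functions, harmonic off a point. -/
lemma harm_removable {u : ℂ → ℝ} {c : ℂ} {r : ℝ} (hcont : ContinuousAt u c)
    (hu : ∀ z ∈ ball c r, z ≠ c → HarmonicAt u z) : HarmonicOnNhd u (ball c r) := by
  rcases le_or_gt r 0 with hr | hr
  · rw [ball_eq_empty.2 hr]; intro z hz; exact hz.elim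
  set k : ℂ → ℂ := fun z => fderiv ℝ u z 1 - Complex.I * fderiv ℝ u z Complex.I with hk
  have hkd : DifferentiableOn ℂ k (ball c r \ {c}) := fun z hz =>
    (HarmonicAt.differentiableAt_complex_partial (hu z hz.1 hz.2)).differentiableWithinAt
  have loc : ∀ z ρ, ball z ρ ⊆ ball c r \ {c} → ∃ F : ℂ → ℂ, DifferentiableOn ℂ F (ball z ρ) ∧
      (∀ w ∈ ball z ρ, u w = (F w).re) ∧ ∀ w ∈ ball z ρ, HasDerivAt F (k w) w := by
    intro z ρ hsub
    obtain ⟨F, hF, hFe⟩ := HarmonicOnNhd.exists_analyticOnNhd_ball_re_eq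
      (f := u) (z := z) (R := ρ) (fun w hw => hu w (hsub hw).1 (hsub hw).2)
    refine ⟨F, hF.differentiableOn, fun w hw => (hFe hw).symm, fun w hw => ?_⟩
    have h1 := (hF w hw).differentiableAt.hasDerivAt
    have h2 := fderiv_re (u := u) h1 (by
      filter_upwards [isOpen_ball.mem_nhds hw] with x hx using (hFe hx).symm)
    have h3 : k w = deriv F w := by
      simp only [hk, h2.fderiv]
      apply Complex.ext <;> simp
    rw [h3]; exact h1
  have ho : (fun z => k z - k c) =o[𝓝[≠] c] fun z => (z - c)⁻¹ := by
    have hconst : (fun _ : ℂ => k c) =o[𝓝[≠] c] fun z => (z - c)⁻¹ := by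
      rw [Asymptotics.isLittleO_const_left]
      right
      have : Tendsto (fun z : ℂ => z - c) (𝓝[≠] c) (𝓝[≠] 0) := by
        refine tendsto_nhdsWithin_of_tendsto_nhds_of_eventually_within _ ?_ ?_
        · have : Tendsto (fun z : ℂ => z - c) (𝓝 c) (𝓝 (c - c)) :=
            (continuous_id.sub continuous_const).tendsto c
          rw [sub_self] at this
          exact this.mono_left nhdsWithin_le_nhds
        · filter_upwards [self_mem_nhdsWithin] with z hz using sub_ne_zero.2 hz
      exact (tendsto_norm_inv_nhdsNE_zero_atTop).comp this
    refine Asymptotics.IsLittleO.sub ?_ hconst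
    rw [Asymptotics.isLittleO_iff]
    intro ε hε
    obtain ⟨δ, hδ, hδ'⟩ := Metric.continuousAt_iff.1 hcont (ε / 32) (by linarith)
    have hm : ball c (min δ r / 2) ∈ 𝓝[≠] c :=
      mem_nhdsWithin_of_mem_nhds (ball_mem_nhds _ (by positivity))
    filter_upwards [hm, self_mem_nhdsWithin] with z hz hzc
    have hzc' : z ≠ c := hzc
    set ρ := ‖z - c‖ with hρ
    have hρ0 : 0 < ρ := norm_pos_iff.2 (sub_ne_zero.2 hzc')
    have hzd : ρ < min δ r / 2 := by simpa [dist_eq_norm] using hz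
    have hmin1 := min_le_left δ r
    have hmin2 := min_le_right δ r
    have hball : ∀ w ∈ ball z ρ, dist w c < min δ r := by
      intro w hw
      have h1 : dist w z < ρ := hw
      have h2 : dist z c = ρ := dist_eq_norm _ _
      have := dist_triangle w z c
      linarith
    have hsub : ball z ρ ⊆ ball c r \ {c} := by
      intro w hw
      refine ⟨lt_of_lt_of_le (hball w hw) hmin2, ?_⟩
      rintro rfl
      have h1 : dist w z < ρ := hw
      rw [dist_comm, dist_eq_norm] at h1
      exact lt_irrefl _ h1
    obtain ⟨F, hFd, hFu, hFk⟩ := loc z ρ hsub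
    have hz0 : z ∈ ball z ρ := mem_ball_self hρ0
    have hsm : ∀ w ∈ ball z ρ, |u w - u c| < ε / 32 := fun w hw =>
      hδ' (lt_of_lt_of_le (hball w hw) hmin1)
    have hbd : ∀ w ∈ ball z (ρ / 2), ‖F w - F z‖ ≤ ε / 8 := by
      intro w hw
      have := bc_center (f := fun w => F w - F z) (c := z) (R := ρ) (M := ε / 16) hρ0
        (by linarith) (hFd.sub_const _) (fun x hx => by
          have h1 := hsm x hx
          have h2 := hsm z hz0
          rw [hFu x hx] at h1
          rw [hFu z hz0] at h2
          rw [abs_lt] at h1 h2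
          simp only [Complex.sub_re]; linarith [h1.2, h2.1]) (by simp) hw
      linarith
    have hder := Complex.norm_deriv_le_of_forall_mem_sphere_norm_le (f := fun w => F w - F z)
      (c := z) (R := ρ / 4) (C := ε / 8) (by linarith) (by
        refine DifferentiableOn.diffContOnCl ?_
        refine (hFd.sub_const _).mono ?_
        rw [closure_ball _ (by linarith)]
        exact closedBall_subset_ball (by linarith)) (by
        intro w hw
        exact hbd w (by
          have : dist w z = ρ / 4 := hw
          simp only [mem_ball]; linarith))
    rw [deriv_sub_const, (hFk z hz0).deriv] at hder
    refine hder.trans ?_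
    rw [norm_inv, ← hρ, ← div_eq_mul_inv, div_div_eq_mul_div]
    gcongr; linarith
  have hupd := Complex.differentiableOn_update_limUnder_of_isLittleO (ball_mem_nhds c hr) hkd ho
  obtain ⟨m, hm⟩ := hupd.isExactOn_ball
  have hmd : DifferentiableOn ℂ m (ball c r) := fun z hz =>
    (hm z hz).differentiableAt.differentiableWithinAt
  have hconst : ∀ z ∈ ball c r, u z = (m z).re + (u c - (m c).re) := by
    intro z hz
    rcases eq_or_ne z c with rfl | hzc
    · ring
    set p : ℝ → ℂ := fun t => c + (t : ℂ) * (z - c) with hp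
    have hpc : Continuous p := by fun_prop
    have hpb : ∀ t ∈ Icc (0:ℝ) 1, p t ∈ ball c r := by
      intro t ht
      have : ‖z - c‖ < r := by simpa [dist_eq_norm] using hz
      simp only [hp, mem_ball, dist_eq_norm, add_sub_cancel_left, norm_mul, Complex.norm_real,
        Real.norm_eq_abs, abs_of_nonneg ht.1]
      nlinarith [ht.2, norm_nonneg (z - c)]
    have hpd : ∀ t, HasDerivAt p (z - c) t := by
      intro t
      have := ((Complex.ofRealCLM.hasDerivAt (x := t)).mul_const (z - c)).const_add c
      simpa [hp] using this
    have hder : ∀ t ∈ Ioo (0:ℝ) 1, HasDerivAt (fun t => u (p t) - (m (p t)).re) 0 t := by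
      intro t ht
      have hb := hpb t ⟨ht.1.le, ht.2.le⟩
      have hne : p t ≠ c := by
        simp only [hp, ne_eq, add_eq_left, mul_eq_zero, not_or]
        exact ⟨by exact_mod_cast ht.1.ne', sub_ne_zero.2 hzc⟩
      obtain ⟨ρ, hρ, hsub⟩ := Metric.isOpen_iff.1
        (isOpen_ball.sdiff isClosed_singleton : IsOpen (ball c r \ {c})) (p t) ⟨hb, hne⟩
      obtain ⟨F, -, hFu, hFk⟩ := loc (p t) ρ hsub
      have h1 := fderiv_re (u := u) (hFk _ (mem_ball_self hρ)) (by
        filter_upwards [ball_mem_nhds (p t) hρ] with x hx using hFu x hx)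
      have h2' := hm (p t) hb
      rw [Function.update_of_ne hne] at h2'
      have h2 := fderiv_re (u := fun w => (m w).re) h2' (Eventually.of_forall fun _ => rfl)
      have h3 := (h1.sub h2).comp_hasDerivAt t (hpd t)
      refine HasDerivAt.congr_deriv h3 ?_
      simp
    have hco : ContinuousOn (fun t => u (p t) - (m (p t)).re) (Icc 0 1) := by
      intro t ht
      refine ContinuousAt.continuousWithinAt ?_
      have hb := hpb t ht
      refine ContinuousAt.sub ?_ ?_
      · refine ContinuousAt.comp (f := p) ?_ hpc.continuousAt
        rcases eq_or_ne (p t) c with h | h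
        · rw [h]; exact hcont
        · exact (hu _ hb h).1.continuousAt
      · refine ContinuousAt.comp (f := p) (g := fun w => (m w).re) ?_ hpc.continuousAt
        exact Complex.continuous_re.continuousAt.comp (hm _ hb).continuousAt
    obtain ⟨t, ht, hte⟩ := exists_hasDerivAt_eq_slope _ _ one_pos hco hder
    have e0 : p 0 = c := by simp [hp]
    have e1 : p 1 = z := by simp [hp]
    rw [e0, e1] at hte
    simp only [sub_zero, div_one] at hte
    linarith
  have := harm_re (hmd.add_const ((u c - (m c).re : ℝ) : ℂ))
  refine harm_congr isOpen_ball this (fun z hz => ?_)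
  rw [hconst z hz]; simp

end FJ

namespace FJ

/-- The projection `ℂ² ∖ 0 → ℂ̂`. -/
noncomputable def pr (v : ℂ × ℂ) : CSphere :=
  if v.2 = 0 then CSphere.infty else CSphere.ofC (v.1 / v.2)

/-- The two standard affine sections. -/
def sec (s : Bool) (z : ℂ) : ℂ × ℂ := match s with
  | false => (z, 1)
  | true => (1, z)

/-- The corresponding homogeneous coordinate. -/
def co (s : Bool) (v : ℂ × ℂ) : ℂ := match s with
  | false => v.2
  | true => v.1

@[simp] lemma co_sec (s : Bool) (z : ℂ) : co s (sec s z) = 1 := by cases s <;> rfl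
@[simp] lemma co_sec' (s : Bool) (z : ℂ) : co (!s) (sec s z) = z := by cases s <;> rfl

lemma sec_ne (s : Bool) (z : ℂ) : sec s z ≠ 0 := by
  intro h
  have := co_sec s z
  rw [h] at this
  cases s <;> simp [co] at this

lemma sec_diff (s : Bool) : Differentiable ℂ (sec s) := by
  cases s
  · exact differentiable_id.prodMk (differentiable_const _)
  · exact (differentiable_const _).prodMk differentiable_id

lemma co_diff (s : Bool) : Differentiable ℂ (co s) := by
  cases s
  · exact differentiable_snd
  · exact differentiable_fst

lemma co_smul (s : Bool) (t : ℂ) (v : ℂ × ℂ) : co s (t • v) = t * co s v := by cases s <;> rfl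

lemma norm_eq_co (v : ℂ × ℂ) : ∃ s, ‖v‖ = ‖co s v‖ := by
  rcases le_total ‖v.1‖ ‖v.2‖ with h | h
  · exact ⟨false, by simp [co, Prod.norm_def, h]⟩
  · exact ⟨true, by simp [co, Prod.norm_def, h]⟩

lemma norm_co_le (s : Bool) (v : ℂ × ℂ) : ‖co s v‖ ≤ ‖v‖ := by
  cases s
  · exact norm_snd_le v
  · exact norm_fst_le v

lemma eq_smul_sec {s : Bool} {v : ℂ × ℂ} (h : co s v ≠ 0) :
    v = co s v • sec s (co (!s) v / co s v) := by
  cases s <;> simp only [co, Bool.not_false, Bool.not_true] at * <;> ext <;>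
    simp [sec] <;> field_simp

lemma pr_smul {t : ℂ} (ht : t ≠ 0) (v : ℂ × ℂ) : pr (t • v) = pr v := by
  unfold pr
  simp only [Prod.smul_fst, Prod.smul_snd, smul_eq_mul, mul_eq_zero, ht, false_or]
  split_ifs with h
  · rfl
  · rw [mul_div_mul_left _ _ ht]

lemma embed_pr {v : ℂ × ℂ} (hv : v ≠ 0) : CSphere.embed (pr v) =
    ((2 * v.1 * (starRingEnd ℂ) v.2) / ((‖v.1‖ ^ 2 + ‖v.2‖ ^ 2 : ℝ) : ℂ),
      (‖v.1‖ ^ 2 - ‖v.2‖ ^ 2) / (‖v.1‖ ^ 2 + ‖v.2‖ ^ 2)) := by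
  unfold pr
  split_ifs with h
  · have h1 : v.1 ≠ 0 := by
      intro h1; exact hv (Prod.ext h1 h)
    have : ‖v.1‖ ≠ 0 := norm_ne_zero_iff.2 h1
    simp [h, this]
  · have h2 : ‖v.2‖ ≠ 0 := norm_ne_zero_iff.2 h
    have h3 : (0:ℝ) < ‖v.1‖ ^ 2 + ‖v.2‖ ^ 2 := by positivity
    have h3' : (‖v.1‖ ^ 2 + ‖v.2‖ ^ 2 : ℂ) ≠ 0 := by exact_mod_cast h3.ne'
    have h2' : (‖v.2‖ : ℂ) ≠ 0 := by exact_mod_cast h2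
    rw [CSphere.embed_ofC]
    ext1
    · simp only [Complex.real_smul, norm_div]
      have h4 : v.2 * (starRingEnd ℂ) v.2 = (‖v.2‖ : ℂ) ^ 2 := Complex.mul_conj' _
      push_cast
      have h5 : (1 + ((‖v.1‖ : ℂ) / ‖v.2‖) ^ 2) = (‖v.1‖ ^ 2 + ‖v.2‖ ^ 2) / ‖v.2‖ ^ 2 := by
        field_simp; ring
      rw [h5]
      field_simp
      linear_combination -v.1 * h4
    · simp only [norm_div]
      field_simp

lemma pr_contOn : ContinuousOn pr {v | v ≠ 0} := by
  have hind : IsInducing CSphere.embed := ⟨rfl⟩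
  rw [hind.continuousOn_iff]
  have : ContinuousOn (fun v : ℂ × ℂ => (((2 * v.1 * (starRingEnd ℂ) v.2) /
    ((‖v.1‖ ^ 2 + ‖v.2‖ ^ 2 : ℝ) : ℂ),
      (‖v.1‖ ^ 2 - ‖v.2‖ ^ 2) / (‖v.1‖ ^ 2 + ‖v.2‖ ^ 2)) : ℂ × ℝ)) {v | v ≠ 0} := by
    have hne : ∀ v ∈ {v : ℂ × ℂ | v ≠ 0}, ‖v.1‖ ^ 2 + ‖v.2‖ ^ 2 ≠ 0 := by
      intro v hv h
      apply hv
      have h1 : ‖v.1‖ = 0 := by nlinarith [sq_nonneg ‖v.1‖, sq_nonneg ‖v.2‖]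
      have h2 : ‖v.2‖ = 0 := by nlinarith [sq_nonneg ‖v.1‖, sq_nonneg ‖v.2‖]
      exact Prod.ext (norm_eq_zero.1 h1) (norm_eq_zero.1 h2)
    refine ContinuousOn.prodMk (ContinuousOn.div ?_ ?_ ?_) (ContinuousOn.div ?_ ?_ hne)
    · have := Complex.continuous_conj
      fun_prop
    · fun_prop
    · intro v hv; exact_mod_cast hne v hv
    · fun_prop
    · fun_prop
  refine this.congr fun v hv => embed_pr hv

/-- A representative. -/
noncomputable def tau (s : Bool) (ζ : CSphere) : ℂ := match s with
  | false => (CSphere.embed ζ).1 / ((1 - (CSphere.embed ζ).2 : ℝ) : ℂ)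
  | true => (starRingEnd ℂ) (CSphere.embed ζ).1 / ((1 + (CSphere.embed ζ).2 : ℝ) : ℂ)

lemma embed_cont : Continuous CSphere.embed := (⟨rfl⟩ : IsInducing CSphere.embed).continuous

lemma ne_one_of {ζ : CSphere} : ζ = CSphere.infty ∨ (CSphere.embed ζ).2 ≠ 1 := by
  rcases CSphere.cases' ζ with h | ⟨w, rfl⟩
  · exact Or.inl h
  · right
    rw [CSphere.embed_ofC]
    have : ‖w‖ ^ 2 + 1 ≠ 0 := by positivity
    simp only [ne_eq, div_eq_one_iff_eq this]
    linarith [sq_nonneg ‖w‖]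

lemma tau_pr_sec (s : Bool) (z : ℂ) : tau s (pr (sec s z)) = z := by
  have h0 : (0:ℝ) < 1 + ‖z‖ ^ 2 := by positivity
  have h1 : (1 + ‖z‖ ^ 2 : ℂ) ≠ 0 := by exact_mod_cast h0.ne'
  have h2 : (‖z‖ ^ 2 + 1 : ℂ) ≠ 0 := by rw [add_comm]; exact h1
  cases s
  · simp only [tau, embed_pr (sec_ne false z)]
    simp only [sec, norm_one, map_one]
    push_cast
    have : (1 - ((‖z‖:ℂ) ^ 2 - 1 ^ 2) / (‖z‖ ^ 2 + 1 ^ 2)) = 2 / (‖z‖ ^ 2 + 1 ) := by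
      field_simp; ring
    rw [this]; field_simp
  · simp only [tau, embed_pr (sec_ne true z)]
    simp only [sec, norm_one]
    push_cast
    have : (1 + ((1:ℂ) ^ 2 - ‖z‖ ^ 2) / (1 ^ 2 + ‖z‖ ^ 2)) = 2 / (1 + ‖z‖ ^ 2) := by
      field_simp; ring
    rw [this]
    simp
    field_simp
    have : (starRingEnd ℂ) 2 = 2 := Complex.conj_ofReal 2
    rw [this]; ring

/-- Point covered by the chart `s`. -/
lemma exists_sec (ζ : CSphere) : ∃ s, ∃ z : ℂ, ‖z‖ ≤ 1 ∧ pr (sec s z) = ζ := by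
  rcases CSphere.cases' ζ with rfl | ⟨w, rfl⟩
  · exact ⟨true, 0, by simp, by simp [pr, sec]⟩
  · rcases le_total ‖w‖ 1 with h | h
    · exact ⟨false, w, h, by simp [pr, sec]⟩
    · have : w ≠ 0 := by rintro rfl; simp at h; linarith
      refine ⟨true, w⁻¹, ?_, ?_⟩
      · rw [norm_inv]; exact inv_le_one_of_one_le₀ h
      · simp [pr, sec, this]

lemma pr_sec_cont (s : Bool) : Continuous (fun z => pr (sec s z)) := by
  rw [← continuousOn_univ]
  exact pr_contOn.comp (sec_diff s).continuous.continuousOn fun z _ => sec_ne s z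

instance : CompactSpace CSphere := by
  refine ⟨?_⟩
  have h : (univ : Set CSphere) = (fun z => pr (sec false z)) '' closedBall 0 1 ∪
      (fun z => pr (sec true z)) '' closedBall 0 1 := by
    refine (eq_univ_of_forall fun ζ => ?_).symm
    obtain ⟨s, z, hz, h⟩ := exists_sec ζ
    cases s
    · exact Or.inl ⟨z, by simpa using hz, h⟩
    · exact Or.inr ⟨z, by simpa using hz, h⟩
  rw [h]
  exact ((isCompact_closedBall _ _).image (pr_sec_cont _)).union
    ((isCompact_closedBall _ _).image (pr_sec_cont _))

/-- local inverse of `pr ∘ sec s`. -/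
lemma tau_contAt (s : Bool) (z : ℂ) : ContinuousAt (tau s) (pr (sec s z)) := by
  have h0 : (0:ℝ) < 1 + ‖z‖ ^ 2 := by positivity
  have e := embed_cont
  cases s
  · refine ContinuousAt.div (by fun_prop) (by fun_prop) ?_
    rw [embed_pr (sec_ne false z)]
    simp only [sec, norm_one, one_pow]
    norm_cast
    have : ‖z‖ ^ 2 + 1 ≠ 0 := by positivity
    rw [one_sub_div this]
    ring_nf
    positivity
  · have := Complex.continuous_conj
    refine ContinuousAt.div (by fun_prop) (by fun_prop) ?_
    rw [embed_pr (sec_ne true z)]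
    simp only [sec, norm_one, one_pow]
    norm_cast
    rw [one_add_div h0.ne']
    ring_nf
    positivity

/-- `rho s (pr v) = |v_s| / ‖v‖`. -/
noncomputable def rho (s : Bool) (ζ : CSphere) : ℝ :=
  Real.sqrt ((match s with
    | false => 1 - (CSphere.embed ζ).2
    | true => 1 + (CSphere.embed ζ).2) /
    max (1 - (CSphere.embed ζ).2) (1 + (CSphere.embed ζ).2))

lemma rho_cont (s : Bool) : Continuous (rho s) := by
  have e := embed_cont
  have hne : ∀ ζ, max (1 - (CSphere.embed ζ).2) (1 + (CSphere.embed ζ).2) ≠ 0 := by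
    intro ζ
    have : 0 < max (1 - (CSphere.embed ζ).2) (1 + (CSphere.embed ζ).2) := by
      rw [lt_max_iff]
      by_contra h
      push Not at h
      linarith
    exact this.ne'
  refine Real.continuous_sqrt.comp (Continuous.div ?_ (by fun_prop) hne)
  cases s <;> simp only <;> fun_prop

lemma rho_pr (s : Bool) {v : ℂ × ℂ} (hv : v ≠ 0) : rho s (pr v) = ‖co s v‖ / ‖v‖ := by
  have h0 : 0 < ‖v‖ := norm_pos_iff.2 hv
  have hp : 0 < ‖v.1‖ ^ 2 + ‖v.2‖ ^ 2 := by
    have := h0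
    rw [Prod.norm_def, lt_max_iff] at this
    rcases this with h | h <;> positivity
  have e1 : 1 - (‖v.1‖ ^ 2 - ‖v.2‖ ^ 2) / (‖v.1‖ ^ 2 + ‖v.2‖ ^ 2) =
    ‖v.2‖ ^ 2 * (2 / (‖v.1‖ ^ 2 + ‖v.2‖ ^ 2)) := by field_simp; ring
  have e2 : 1 + (‖v.1‖ ^ 2 - ‖v.2‖ ^ 2) / (‖v.1‖ ^ 2 + ‖v.2‖ ^ 2) =
    ‖v.1‖ ^ 2 * (2 / (‖v.1‖ ^ 2 + ‖v.2‖ ^ 2)) := by field_simp; ring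
  have e3 : max (‖v.2‖ ^ 2 * (2 / (‖v.1‖ ^ 2 + ‖v.2‖ ^ 2)))
      (‖v.1‖ ^ 2 * (2 / (‖v.1‖ ^ 2 + ‖v.2‖ ^ 2))) =
      ‖v‖ ^ 2 * (2 / (‖v.1‖ ^ 2 + ‖v.2‖ ^ 2)) := by
    rw [← max_mul_of_nonneg _ _ (by positivity), max_comm, Prod.norm_def]
    congr 1
    exact ((pow_left_monotoneOn (n := 2)).map_max (norm_nonneg v.1) (norm_nonneg v.2)).symm
  unfold rho
  rw [embed_pr hv]
  simp only [e1, e2, e3]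
  have hc : (2 / (‖v.1‖ ^ 2 + ‖v.2‖ ^ 2)) ≠ 0 := by positivity
  cases s <;> simp only [co]
  · rw [mul_div_mul_right _ _ hc, ← div_pow, Real.sqrt_sq (by positivity)]
  · rw [mul_div_mul_right _ _ hc, ← div_pow, Real.sqrt_sq (by positivity)]

lemma pr_sec_tau_ev (s : Bool) (z : ℂ) : ∀ᶠ ζ in 𝓝 (pr (sec s z)), pr (sec s (tau s ζ)) = ζ := by
  have hh : ∀ ζ : CSphere, (∃ w, ζ = pr (sec s w)) → pr (sec s (tau s ζ)) = ζ := by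
    rintro ζ ⟨w, rfl⟩
    rw [tau_pr_sec]
  have hb : ∀ ζ : CSphere, ζ ≠ pr (sec (!s) 0) → ∃ w, ζ = pr (sec s w) := by
    intro ζ hζ
    obtain ⟨s', w, -, rfl⟩ := exists_sec ζ
    by_cases h : s' = s
    · subst h; exact ⟨w, rfl⟩
    · have : s' = !s := by cases s <;> cases s' <;> simp_all
      subst this
      have hw : w ≠ 0 := by rintro rfl; exact hζ rfl
      have hc : co s (sec (!s) w) = w := by have := co_sec' (!s) w; simpa using this
      have := eq_smul_sec (s := s) (v := sec (!s) w) (by rw [hc]; exact hw)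
      refine ⟨_, (congrArg pr this).trans (pr_smul (by rw [hc]; exact hw) _)⟩
  have hne : pr (sec s z) ≠ pr (sec (!s) 0) := by
    intro h
    have h1 := congrArg (rho s) h
    have hc : co s (sec (!s) 0) = 0 := by have := co_sec' (!s) 0; simpa using this
    rw [rho_pr s (sec_ne _ _), rho_pr s (sec_ne _ _), co_sec, hc, norm_zero, zero_div] at h1
    have := norm_pos_iff.2 (sec_ne s z)
    rw [norm_one] at h1
    exact (one_div_pos.2 this).ne' h1
  filter_upwards [isOpen_ne.mem_nhds hne] with ζ hζ using hh ζ (hb ζ hζ)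

lemma exists_rep (ζ : CSphere) : ∃ v : ℂ × ℂ, v ≠ 0 ∧ pr v = ζ := by
  obtain ⟨s, z, -, h⟩ := exists_sec ζ
  exact ⟨_, sec_ne s z, h⟩

lemma exists_rho (ζ : CSphere) : ∃ s, rho s ζ = 1 := by
  obtain ⟨v, hv, rfl⟩ := exists_rep ζ
  obtain ⟨s, hs⟩ := norm_eq_co v
  exact ⟨s, by rw [rho_pr s hv, hs, div_self]; rw [← hs]; exact norm_ne_zero_iff.2 hv⟩

lemma pr_eq {v w : ℂ × ℂ} (hv : v ≠ 0) (hw : w ≠ 0) (h : pr v = pr w) :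
    ∃ t : ℂ, t ≠ 0 ∧ w = t • v := by
  obtain ⟨s, hs⟩ := norm_eq_co v
  have h1 : co s v ≠ 0 := norm_ne_zero_iff.1 (by rw [← hs]; exact norm_ne_zero_iff.2 hv)
  have h2 : co s w ≠ 0 := by
    have := rho_pr s hv
    rw [h, rho_pr s hw] at this
    intro h0
    rw [h0, norm_zero, zero_div, hs] at this
    rw [div_self (norm_ne_zero_iff.2 h1)] at this
    exact zero_ne_one this
  have e1 := eq_smul_sec h1
  have e2 := eq_smul_sec h2
  have h3 : co (!s) v / co s v = co (!s) w / co s w := by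
    rw [e1, e2, pr_smul h1, pr_smul h2] at h
    have := congrArg (tau s) h
    rwa [tau_pr_sec, tau_pr_sec] at this
  refine ⟨co s w / co s v, div_ne_zero h2 h1, ?_⟩
  calc w = co s w • sec s (co (!s) w / co s w) := e2
    _ = (co s w / co s v) • (co s v • sec s (co (!s) v / co s v)) := by
      rw [smul_smul, div_mul_cancel₀ _ h1, h3]
    _ = _ := by rw [← e1]

end FJ

namespace FJ

open InnerProductSpace

structure IsLift (φ : CSphere → CSphere) (d : ℕ) (Φ : ℂ × ℂ → ℂ × ℂ) : Prop where
  diff : Differentiable ℂ Φ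
  hom : ∀ t : ℂ, t ≠ 0 → ∀ v, Φ (t • v) = t ^ d • Φ v
  ne : ∀ v, v ≠ 0 → Φ v ≠ 0
  spec : ∀ v, v ≠ 0 → pr (Φ v) = φ (pr v)

lemma IsLift.comp {φ ψ : CSphere → CSphere} {d e : ℕ} {Φ Ψ : ℂ × ℂ → ℂ × ℂ}
    (hΨ : IsLift ψ e Ψ) (hΦ : IsLift φ d Φ) : IsLift (ψ ∘ φ) (d * e) (Ψ ∘ Φ) where
  diff := hΨ.diff.comp hΦ.diff
  hom t ht v := by
    simp only [Function.comp]
    rw [hΦ.hom t ht, hΨ.hom _ (pow_ne_zero _ ht), pow_mul]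
  ne v hv := hΨ.ne _ (hΦ.ne _ hv)
  spec v hv := by
    simp only [Function.comp]
    rw [hΨ.spec _ (hΦ.ne _ hv), hΦ.spec _ hv]

lemma IsLift.smul {φ : CSphere → CSphere} {d : ℕ} {Φ : ℂ × ℂ → ℂ × ℂ}
    (hΦ : IsLift φ d Φ) {c : ℂ} (hc : c ≠ 0) : IsLift φ d (fun v => c • Φ v) where
  diff := hΦ.diff.const_smul c
  hom t ht v := by rw [hΦ.hom t ht, smul_comm]
  ne v hv := smul_ne_zero hc (hΦ.ne v hv)
  spec v hv := by rw [pr_smul hc, hΦ.spec v hv]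

lemma IsLift.congr {φ ψ : CSphere → CSphere} {d : ℕ} {Φ : ℂ × ℂ → ℂ × ℂ}
    (hΦ : IsLift φ d Φ) (h : ∀ ζ, ψ ζ = φ ζ) : IsLift ψ d Φ :=
  ⟨hΦ.diff, hΦ.hom, hΦ.ne, fun v hv => by rw [h, hΦ.spec v hv]⟩

lemma isLift_id : IsLift (fun ζ => ζ) 1 (fun v => v) :=
  ⟨differentiable_id, fun t _ v => by simp, fun v hv => hv, fun v _ => rfl⟩

lemma IsLift.log_hom {φ : CSphere → CSphere} {d : ℕ} {Φ : ℂ × ℂ → ℂ × ℂ}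
    (hΦ : IsLift φ d Φ) {t : ℂ} (ht : t ≠ 0) {v : ℂ × ℂ} (hv : v ≠ 0) :
    Real.log ‖Φ (t • v)‖ = d * Real.log ‖t‖ + Real.log ‖Φ v‖ := by
  rw [hΦ.hom t ht, norm_smul, norm_pow, Real.log_mul, Real.log_pow]
  · exact pow_ne_zero _ (norm_ne_zero_iff.2 ht)
  · exact norm_ne_zero_iff.2 (hΦ.ne v hv)

lemma IsLift.log_cont {φ : CSphere → CSphere} {d : ℕ} {Φ : ℂ × ℂ → ℂ × ℂ}
    (hΦ : IsLift φ d Φ) : ContinuousOn (fun v => Real.log ‖Φ v‖) {v | v ≠ 0} := by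
  refine ContinuousOn.log hΦ.diff.continuous.norm.continuousOn ?_
  intro v hv
  exact norm_ne_zero_iff.2 (hΦ.ne v hv)

/-- homogenization -/
noncomputable def hmg (p : Polynomial ℂ) (n : ℕ) (v : ℂ × ℂ) : ℂ :=
  ∑ k ∈ Finset.range (n + 1), p.coeff k * v.1 ^ k * v.2 ^ (n - k)

lemma hmg_diff (p : Polynomial ℂ) (n : ℕ) : Differentiable ℂ (hmg p n) := by
  unfold hmg
  fun_prop

lemma hmg_smul (p : Polynomial ℂ) (n : ℕ) (t : ℂ) (v : ℂ × ℂ) :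
    hmg p n (t • v) = t ^ n * hmg p n v := by
  unfold hmg
  rw [Finset.mul_sum]
  refine Finset.sum_congr rfl fun k hk => ?_
  have : n = k + (n - k) := by have := Finset.mem_range.1 hk; omega
  simp only [Prod.smul_fst, Prod.smul_snd, smul_eq_mul, mul_pow]
  conv_rhs => rw [this, pow_add]
  simp only [Nat.add_sub_cancel_left]
  ring

lemma hmg_ne {p : Polynomial ℂ} {n : ℕ} (hn : p.natDegree ≤ n) {v : ℂ × ℂ} (hv : v.2 ≠ 0) :
    hmg p n v = v.2 ^ n * p.eval (v.1 / v.2) := by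
  rw [Polynomial.eval_eq_sum_range' (Nat.lt_succ_of_le hn), Finset.mul_sum]
  refine Finset.sum_congr rfl fun k hk => ?_
  have : n = k + (n - k) := by have := Finset.mem_range.1 hk; omega
  conv_rhs => rw [this, pow_add]
  rw [div_pow]
  field_simp

lemma hmg_zero (p : Polynomial ℂ) (n : ℕ) {v : ℂ × ℂ} (hv : v.2 = 0) :
    hmg p n v = p.coeff n * v.1 ^ n := by
  unfold hmg
  rw [Finset.sum_range_succ, Finset.sum_eq_zero]
  · simp
  · intro k hk
    have : n - k ≠ 0 := by have := Finset.mem_range.1 hk; omega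
    simp [hv, this]

lemma ratLift_lift {p q : Polynomial ℂ} (hq : q ≠ 0) (hpq : IsCoprime p q) :
    IsLift (CSphere.ratLift p q) (max p.natDegree q.natDegree)
      (fun v => (hmg p (max p.natDegree q.natDegree) v, hmg q (max p.natDegree q.natDegree) v)) := by
  set n := max p.natDegree q.natDegree with hn
  have hp' : p.natDegree ≤ n := le_max_left _ _
  have hq' : q.natDegree ≤ n := le_max_right _ _
  refine ⟨(hmg_diff p n).prodMk (hmg_diff q n), ?_, ?_, ?_⟩
  · intro t _ v
    ext <;> simp [hmg_smul]
  · intro v hv h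
    have h1 : hmg p n v = 0 := congrArg Prod.fst h
    have h2 : hmg q n v = 0 := congrArg Prod.snd h
    by_cases h0 : v.2 = 0
    · have hv1 : v.1 ≠ 0 := fun h1 => hv (Prod.ext h1 h0)
      rw [hmg_zero _ _ h0, mul_eq_zero, or_iff_left (pow_ne_zero _ hv1)] at h1 h2
      rcases le_or_gt p.natDegree q.natDegree with hle | hlt
      · have : n = q.natDegree := max_eq_right hle
        rw [this] at h2
        exact hq (Polynomial.leadingCoeff_eq_zero.1 h2)
      · have : n = p.natDegree := max_eq_left hlt.le
        rw [this] at h1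
        have := Polynomial.leadingCoeff_eq_zero.1 h1
        simp [this] at hlt
    · rw [hmg_ne hp' h0, mul_eq_zero, or_iff_right (pow_ne_zero _ h0)] at h1
      rw [hmg_ne hq' h0, mul_eq_zero, or_iff_right (pow_ne_zero _ h0)] at h2
      obtain ⟨a, b, hab⟩ := hpq
      have := congrArg (Polynomial.eval (v.1 / v.2)) hab
      simp [h1, h2] at this
  · intro v hv
    by_cases h0 : v.2 = 0
    · have hv1 : v.1 ≠ 0 := fun h1 => hv (Prod.ext h1 h0)
      have hpr : pr v = CSphere.infty := by simp [pr, h0]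
      rw [hpr]
      change _ = (if q.natDegree < p.natDegree then CSphere.infty
        else if p.natDegree < q.natDegree then CSphere.ofC 0
        else CSphere.ofC (p.leadingCoeff / q.leadingCoeff))
      unfold pr
      simp only [hmg_zero _ _ h0, mul_eq_zero, pow_eq_zero_iff', hv1, false_and, or_false,
        ne_eq]
      rw [mul_div_mul_right _ _ (pow_ne_zero _ hv1)]
      rcases lt_trichotomy p.natDegree q.natDegree with h | h | h
      · have : n = q.natDegree := max_eq_right h.le
        rw [if_neg, if_neg h.not_gt, if_pos h, this, Polynomial.coeff_eq_zero_of_natDegree_lt h,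
          zero_div]
        rw [this]; exact fun h => hq (Polynomial.leadingCoeff_eq_zero.1 h)
      · have : n = q.natDegree := max_eq_right h.le
        rw [if_neg, if_neg h.not_gt, if_neg h.not_lt, this]
        · simp only [Polynomial.leadingCoeff, h]
        rw [this]; exact fun h => hq (Polynomial.leadingCoeff_eq_zero.1 h)
      · have : n = p.natDegree := max_eq_left h.le
        rw [if_pos, if_pos h]
        rw [this]; exact Polynomial.coeff_eq_zero_of_natDegree_lt h
    · have hpr : pr v = CSphere.ofC (v.1 / v.2) := by simp [pr, h0]
      rw [hpr]
      change _ = (if q.eval (v.1 / v.2) = 0 then CSphere.infty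
        else CSphere.ofC (p.eval (v.1 / v.2) / q.eval (v.1 / v.2)))
      unfold pr
      simp only [hmg_ne hp' h0, hmg_ne hq' h0, mul_eq_zero, pow_eq_zero_iff', h0, false_and,
        false_or, ne_eq]
      rw [mul_div_mul_left _ _ (pow_ne_zero _ h0)]

/-! ### log of the norm of a holomorphic function -/

lemma log_re {q : ℂ → ℂ} {c : ℂ} {r : ℝ} (hq : DifferentiableOn ℂ q (ball c r))
    (h0 : ∀ z ∈ ball c r, q z ≠ 0) :
    ∃ h : ℂ → ℂ, DifferentiableOn ℂ h (ball c r) ∧ ∀ z ∈ ball c r, (h z).re = Real.log ‖q z‖ := by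
  have hh : HarmonicOnNhd (fun z => Real.log ‖q z‖) (ball c r) := by
    intro z hz
    exact AnalyticAt.harmonicAt_log_norm (hq.analyticAt (isOpen_ball.mem_nhds hz)) (h0 z hz)
  obtain ⟨F, hF, hFe⟩ := hh.exists_analyticOnNhd_ball_re_eq
  exact ⟨F, hF.differentiableOn, fun z hz => hFe hz⟩

lemma lift_logre {φ : CSphere → CSphere} {d : ℕ} {Φ : ℂ × ℂ → ℂ × ℂ} (hΦ : IsLift φ d Φ)
    {s t : Bool} {c : ℂ} {r : ℝ} (h0 : ∀ z ∈ ball c r, 0 < rho t (φ (pr (sec s z)))) :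
    ∃ h : ℂ → ℂ, DifferentiableOn ℂ h (ball c r) ∧ ∀ z ∈ ball c r,
      Real.log ‖Φ (sec s z)‖ = (h z).re - Real.log (rho t (φ (pr (sec s z)))) := by
  have key : ∀ z, rho t (φ (pr (sec s z))) = ‖co t (Φ (sec s z))‖ / ‖Φ (sec s z)‖ := by
    intro z
    rw [← hΦ.spec _ (sec_ne s z), rho_pr t (hΦ.ne _ (sec_ne s z))]
  have hne : ∀ z ∈ ball c r, co t (Φ (sec s z)) ≠ 0 := by
    intro z hz h
    have := h0 z hz
    rw [key, h] at this
    simp at this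
  obtain ⟨h, hd, he⟩ := log_re (q := fun z => co t (Φ (sec s z))) (c := c) (r := r)
    ((((co_diff t).comp hΦ.diff).comp (sec_diff s)).differentiableOn) hne
  refine ⟨h, hd, fun z hz => ?_⟩
  rw [he z hz, key, Real.log_div (norm_ne_zero_iff.2 (hne z hz))
    (norm_ne_zero_iff.2 (hΦ.ne _ (sec_ne s z)))]
  ring

/-! ### Lemma L -/

lemma L0 {α : Type*} (𝒰 : Ultrafilter α) (H : α → ℂ × ℂ → ℝ) (D : α → ℤ)
    (hc : ∀ k, ContinuousOn (H k) {v | v ≠ 0})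
    (hh : ∀ k (t : ℂ) v, t ≠ 0 → v ≠ 0 → H k (t • v) = D k * Real.log ‖t‖ + H k v)
    (hA : ∀ s, AlmostHarm (𝒰 : Filter α) (fun k z => H k (sec s z)))
    (hD : ∀ᶠ k in (𝒰 : Filter α), 0 ≤ D k) {ε : ℝ} (hε : 0 < ε) :
    ∀ᶠ k in (𝒰 : Filter α), D k = 0 ∧ ∃ c, ∀ v, v ≠ 0 → |H k v - c| ≤ ε := by
  have hmin : ∀ k, ∃ s : Bool, ∃ a : ℂ, ‖a‖ ≤ 1 ∧ ∀ v, v ≠ 0 →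
      D k * Real.log ‖v‖ + H k (sec s a) ≤ H k v := by
    intro k
    have hcpt : IsCompact (sphere (0 : ℂ × ℂ) 1) := isCompact_sphere 0 1
    obtain ⟨v₀, hv₀, hm⟩ := hcpt.exists_isMinOn (f := H k) ⟨(1, 0), by simp [Prod.norm_def]⟩
      ((hc k).mono fun v hv h => by simp [h] at hv)
    have hv1 : ‖v₀‖ = 1 := by simpa using hv₀
    have hvne : v₀ ≠ 0 := by rintro rfl; simp at hv1
    obtain ⟨s, hs⟩ := norm_eq_co v₀
    rw [hv1] at hs
    have hcne : co s v₀ ≠ 0 := by rw [← norm_ne_zero_iff, ← hs]; exact one_ne_zero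
    refine ⟨s, co (!s) v₀ / co s v₀, ?_, ?_⟩
    · rw [norm_div, ← hs, div_one, ← hv1]; exact norm_co_le _ _
    · intro v hv
      have e1 : H k v₀ = H k (sec s (co (!s) v₀ / co s v₀)) := by
        conv_lhs => rw [eq_smul_sec hcne]
        rw [hh k _ _ hcne (sec_ne _ _), ← hs]; simp
      rw [← e1]
      have hn : ‖v‖ ≠ 0 := norm_ne_zero_iff.2 hv
      have hnc : ((‖v‖ : ℂ)⁻¹) ≠ 0 := inv_ne_zero (by exact_mod_cast hn)
      have h1 : H k v₀ ≤ H k ((‖v‖ : ℂ)⁻¹ • v) := hm (by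
        rw [mem_sphere_zero_iff_norm, norm_smul, norm_inv, Complex.norm_real, norm_norm,
          inv_mul_cancel₀ hn])
      rw [hh k _ _ hnc hv, norm_inv, Complex.norm_real, norm_norm, Real.log_inv] at h1
      linarith
  choose s a ha hmin using hmin
  obtain ⟨s₀, hs₀⟩ : ∃ s₀, ∀ᶠ k in (𝒰 : Filter α), s k = s₀ := by
    rcases 𝒰.em (fun k => s k = true) with h | h
    · exact ⟨true, h⟩
    · exact ⟨false, h.mono fun k hk => by simpa using hk⟩
  obtain ⟨a₀, -, ha₀⟩ : ∃ a₀ ∈ closedBall (0 : ℂ) 1, Tendsto a (𝒰 : Filter α) (𝓝 a₀) := by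
    have := (isCompact_closedBall (0:ℂ) 1).ultrafilter_le_nhds' (𝒰.map a)
      (by
        rw [Ultrafilter.mem_map]
        exact Eventually.of_forall fun k => by simpa using ha k)
    obtain ⟨x, hx, hx'⟩ := this
    exact ⟨x, hx, hx'⟩
  have hsec1 : ∀ (s : Bool) z, 1 ≤ ‖sec s z‖ := by
    intro s z
    have := norm_co_le s (sec s z)
    rwa [co_sec, norm_one] at this
  have hpos : ∀ s', ∀ᶠ k in (𝒰 : Filter α), ∀ z, 0 ≤ H k (sec s' z) - H k (sec (s k) (a k)) := by
    intro s'
    filter_upwards [hD] with k hk z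
    have h1 := hmin k (sec s' z) (sec_ne _ _)
    have h2 : 0 ≤ D k * Real.log ‖sec s' z‖ :=
      mul_nonneg (by exact_mod_cast hk) (Real.log_nonneg (hsec1 _ _))
    linarith
  have ch1 : ∀ ε > (0:ℝ), ∀ᶠ k in (𝒰 : Filter α), ∀ z ∈ closedBall (0:ℂ) 2,
      H k (sec s₀ z) - H k (sec (s k) (a k)) ≤ ε := by
    intro ε hε
    refine chain (hpos s₀) ((hA s₀).sub_const _) ha₀ ?_ (isCompact_closedBall _ _) hε
    intro η hη
    filter_upwards [hs₀] with k hk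
    rw [hk]; simp [hη.le]
  have hD0 : ∀ᶠ k in (𝒰 : Filter α), D k = 0 := by
    have hl : 0 < Real.log 2 := Real.log_pos one_lt_two
    filter_upwards [ch1 (Real.log 2 / 2) (by linarith), hD] with k h1 h2
    by_contra h3
    have h4 : (1 : ℝ) ≤ D k := by exact_mod_cast (by omega : (1:ℤ) ≤ D k)
    have h5 := h1 2 (by simp)
    have h6 := hmin k (sec s₀ 2) (sec_ne _ _)
    have h7 : Real.log 2 ≤ Real.log ‖sec s₀ 2‖ := by
      refine Real.log_le_log two_pos ?_
      have := norm_co_le (!s₀) (sec s₀ 2)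
      rw [co_sec'] at this
      simpa using this
    nlinarith
  have hone : ∀ s : Bool, sec s 1 = (1, 1) := by intro s; cases s <;> rfl
  have ch2 : ∀ s', ∀ ε > (0:ℝ), ∀ᶠ k in (𝒰 : Filter α), ∀ z ∈ closedBall (0:ℂ) 1,
      H k (sec s' z) - H k (sec (s k) (a k)) ≤ ε := by
    intro s' ε hε
    refine chain (hpos s') ((hA s').sub_const _) (tendsto_const_nhds (x := (1:ℂ))) ?_
      (isCompact_closedBall _ _) hε
    intro η hη
    filter_upwards [ch1 η hη] with k hk
    rw [hone s', ← hone s₀]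
    exact hk 1 (by simp)
  filter_upwards [hD0, ch2 true ε hε, ch2 false ε hε, hpos true, hpos false] with k h0 h1 h2 h3 h4
  refine ⟨h0, H k (sec (s k) (a k)), fun v hv => ?_⟩
  obtain ⟨t, ht⟩ := norm_eq_co v
  have hcne : co t v ≠ 0 := by rw [← norm_ne_zero_iff, ← ht]; exact norm_ne_zero_iff.2 hv
  have e : H k v = H k (sec t (co (!t) v / co t v)) := by
    conv_lhs => rw [eq_smul_sec hcne]
    rw [hh k _ _ hcne (sec_ne _ _), h0]; simp
  have hb : co (!t) v / co t v ∈ closedBall (0:ℂ) 1 := by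
    rw [mem_closedBall_zero_iff, norm_div, div_le_one (norm_pos_iff.2 hcne), ← ht]
    exact norm_co_le _ _
  rw [e, abs_le]
  cases t
  · exact ⟨by linarith [h4 (co (!false) v / co false v)], h2 _ hb⟩
  · exact ⟨by linarith [h3 (co (!true) v / co true v)], h1 _ hb⟩

lemma L1 {α : Type*} (𝒰 : Ultrafilter α) (H : α → ℂ × ℂ → ℝ) (D : α → ℤ)
    (hc : ∀ k, ContinuousOn (H k) {v | v ≠ 0})
    (hh : ∀ k (t : ℂ) v, t ≠ 0 → v ≠ 0 → H k (t • v) = D k * Real.log ‖t‖ + H k v)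
    (hA : ∀ s, AlmostHarm (𝒰 : Filter α) (fun k z => H k (sec s z))) {ε : ℝ} (hε : 0 < ε) :
    ∀ᶠ k in (𝒰 : Filter α), D k = 0 ∧ ∃ c, ∀ v, v ≠ 0 → |H k v - c| ≤ ε := by
  rcases 𝒰.em (fun k => 0 ≤ D k) with h | h
  · exact L0 𝒰 H D hc hh hA h hε
  · have := L0 𝒰 (fun k v => - H k v) (fun k => - D k) (fun k => (hc k).neg)
      (fun k t v ht hv => by rw [hh k t v ht hv]; push_cast; ring) (fun s => (hA s).neg)
      (h.mono fun k hk => by omega) hε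
    filter_upwards [this] with k hk
    obtain ⟨h1, c, h2⟩ := hk
    refine ⟨by omega, -c, fun v hv => ?_⟩
    have := h2 v hv
    rw [← abs_neg]
    convert this using 2; ring

lemma abs_log_sub_le {a b : ℝ} (ha : 1 / 2 ≤ a) (hb : 1 / 2 ≤ b) :
    |Real.log a - Real.log b| ≤ 2 * |a - b| := by
  have key : ∀ a b : ℝ, 1 / 2 ≤ a → 1 / 2 ≤ b → Real.log a - Real.log b ≤ 2 * |a - b| := by
    intro a b ha hb
    have ha0 : 0 < a := by linarith
    have hb0 : 0 < b := by linarith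
    rw [← Real.log_div ha0.ne' hb0.ne']
    have h1 := Real.log_le_sub_one_of_pos (div_pos ha0 hb0)
    have h2 : a / b - 1 = (a - b) / b := by field_simp
    rw [h2] at h1
    refine h1.trans ?_
    rw [div_le_iff₀ hb0]
    nlinarith [le_abs_self (a - b), abs_nonneg (a - b)]
  rw [abs_le]
  constructor
  · have := key b a hb ha
    rw [abs_sub_comm] at this
    linarith
  · exact key a b ha hb

lemma IsLift.cont_sec {φ : CSphere → CSphere} {d : ℕ} {Φ : ℂ × ℂ → ℂ × ℂ} (hΦ : IsLift φ d Φ)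
    (s : Bool) : Continuous fun z => φ (pr (sec s z)) := by
  have : (fun z => φ (pr (sec s z))) = fun z => pr (Φ (sec s z)) := by
    funext z; rw [hΦ.spec _ (sec_ne _ _)]
  rw [this, ← continuousOn_univ]
  exact pr_contOn.comp (hΦ.diff.comp (sec_diff s)).continuous.continuousOn
    fun z _ => hΦ.ne _ (sec_ne s z)

/-- Lemma S. -/
lemma lemS {α : Type*} (𝒰 : Ultrafilter α) {φ : α → CSphere → CSphere} {φ₀ : CSphere → CSphere}
    (hφ : TendstoUniformly φ φ₀ (𝒰 : Filter α)) {d : α → ℕ} {d₀ : ℕ}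
    {Φ : α → ℂ × ℂ → ℂ × ℂ} {Φ₀ : ℂ × ℂ → ℂ × ℂ} (hΦ : ∀ k, IsLift (φ k) (d k) (Φ k))
    (hΦ₀ : IsLift φ₀ d₀ Φ₀) {ε : ℝ} (hε : 0 < ε) :
    ∀ᶠ k in (𝒰 : Filter α), d k = d₀ ∧ ∃ c, ∀ v, v ≠ 0 →
      |Real.log ‖Φ k v‖ - Real.log ‖Φ₀ v‖ - c| ≤ ε := by
  have := L1 𝒰 (fun k v => Real.log ‖Φ k v‖ - Real.log ‖Φ₀ v‖) (fun k => (d k : ℤ) - d₀)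
    (fun k => (hΦ k).log_cont.sub hΦ₀.log_cont) (fun k t v ht hv => by
      rw [(hΦ k).log_hom ht hv, hΦ₀.log_hom ht hv]; push_cast; ring) ?_ hε
  · filter_upwards [this] with k hk
    exact ⟨by omega, hk.2⟩
  intro s z₀
  obtain ⟨t, ht⟩ := exists_rho (φ₀ (pr (sec s z₀)))
  have hcont : Continuous fun z => rho t (φ₀ (pr (sec s z))) := (rho_cont t).comp (hΦ₀.cont_sec s)
  obtain ⟨r, hr, hball⟩ := Metric.mem_nhds_iff.1
    (hcont.continuousAt.preimage_mem_nhds (Ioi_mem_nhds (a := 3/4) (b := rho t (φ₀ (pr (sec s z₀))))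
      (by rw [ht]; norm_num)))
  refine ⟨r, hr, fun η hη => ?_⟩
  have huc : UniformContinuous (rho t) := CompactSpace.uniformContinuous_of_continuous (rho_cont t)
  have h1 := Metric.tendstoUniformly_iff.1 (huc.comp_tendstoUniformly hφ) (min (η / 2) (1/4))
    (by positivity)
  filter_upwards [h1] with k hk
  have hlow0 : ∀ z ∈ ball z₀ r, 3 / 4 < rho t (φ₀ (pr (sec s z))) := fun z hz => hball hz
  have hd : ∀ z, |rho t (φ₀ (pr (sec s z))) - rho t (φ k (pr (sec s z)))| < min (η / 2) (1/4) :=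
    fun z => hk (pr (sec s z))
  have hlow : ∀ z ∈ ball z₀ r, 1 / 2 < rho t (φ k (pr (sec s z))) := by
    intro z hz
    have h1 := hlow0 z hz
    have h2 := (hd z).trans_le (min_le_right _ _)
    rw [abs_lt] at h2
    linarith
  obtain ⟨h₀, hd₀, he₀⟩ := lift_logre hΦ₀ (s := s) (t := t) (c := z₀) (r := r)
    (fun z hz => by linarith [hlow0 z hz])
  obtain ⟨h₁, hd₁, he₁⟩ := lift_logre (hΦ k) (s := s) (t := t) (c := z₀) (r := r)
    (fun z hz => by linarith [hlow z hz])
  refine ⟨fun z => h₁ z - h₀ z, hd₁.sub hd₀, fun z hz => ?_⟩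
  rw [he₀ z hz, he₁ z hz, Complex.sub_re]
  have := abs_log_sub_le (by linarith [hlow0 z hz] : 1 / 2 ≤ rho t (φ₀ (pr (sec s z))))
    (hlow z hz).le
  have h2 := (hd z).trans_le (min_le_left _ _)
  have e : (h₁ z).re - Real.log (rho t (φ k (pr (sec s z)))) -
      ((h₀ z).re - Real.log (rho t (φ₀ (pr (sec s z))))) - ((h₁ z).re - (h₀ z).re) =
      Real.log (rho t (φ₀ (pr (sec s z)))) - Real.log (rho t (φ k (pr (sec s z)))) := by ring
  rw [e]
  linarith

/-- Uniqueness of lifts. -/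
lemma lift_unique {φ : CSphere → CSphere} {d d' : ℕ} {Φ Φ' : ℂ × ℂ → ℂ × ℂ}
    (h : IsLift φ d Φ) (h' : IsLift φ d' Φ') : d = d' ∧ ∀ ε > (0:ℝ), ∃ c, ∀ v, v ≠ 0 →
      |Real.log ‖Φ v‖ - Real.log ‖Φ' v‖ - c| ≤ ε := by
  have key : ∀ ε > (0:ℝ), d = d' ∧ ∃ c, ∀ v, v ≠ 0 →
      |Real.log ‖Φ v‖ - Real.log ‖Φ' v‖ - c| ≤ ε := by
    intro ε hε
    have := lemS (pure () : Ultrafilter Unit) (φ := fun _ => φ) (φ₀ := φ) (d := fun _ => d)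
      (Φ := fun _ => Φ) (by
        rw [Metric.tendstoUniformly_iff]
        intro ε hε
        simpa using fun _ => hε) (fun _ => h) h' hε
    simpa using this
  exact ⟨(key 1 one_pos).1, fun ε hε => (key ε hε).2⟩

end FJ

namespace FJ

open InnerProductSpace

lemma IsLift.cont {φ : CSphere → CSphere} {d : ℕ} {Φ : ℂ × ℂ → ℂ × ℂ} (hΦ : IsLift φ d Φ) :
    Continuous φ := by
  rw [continuous_iff_continuousAt]
  intro ζ
  obtain ⟨s, z, -, rfl⟩ := exists_sec ζ
  have h1 : ContinuousAt (fun ζ => φ (pr (sec s (tau s ζ)))) (pr (sec s z)) :=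
    ContinuousAt.comp (f := tau s) (g := fun z => φ (pr (sec s z)))
      (hΦ.cont_sec s).continuousAt (tau_contAt s z)
  refine h1.congr ?_
  filter_upwards [pr_sec_tau_ev s z] with ζ hζ
  rw [hζ]

/-- A compact family of parametrized fibres. -/
structure Mdl (X Y P : Type*) [MetricSpace X] [MetricSpace Y] [MetricSpace P] where
  f : Y → Y
  f_cont : Continuous f
  g : X → X
  g_cont : Continuous g
  b : P → X
  b_cont : Continuous b
  b_surj : Function.Surjective b
  par : P → CSphere → Y
  par_cont : Continuous (Function.uncurry par)
  par_inj : ∀ p, Function.Injective (par p)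
  lift0 : ∀ p q, b q = b p → ∃ φ Φ, IsLift φ 1 Φ ∧ ∀ ζ, par q (φ ζ) = par p ζ
  lift1 : ∀ p q, b q = g (b p) → ∃ φ d Φ, IsLift φ d Φ ∧ 2 ≤ d ∧ ∀ ζ, par q (φ ζ) = f (par p ζ)

namespace Mdl

variable {X Y P : Type*} [MetricSpace X] [MetricSpace Y] [MetricSpace P] (M : Mdl X Y P)

def Rel (n : ℕ) (p q : P) (φ : CSphere → CSphere) : Prop :=
  ∀ ζ, M.par q (φ ζ) = M.f^[n] (M.par p ζ)

variable {M}

lemma Rel.unique {n : ℕ} {p q : P} {φ φ' : CSphere → CSphere} (h : M.Rel n p q φ)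
    (h' : M.Rel n p q φ') : φ = φ' := by
  funext ζ
  exact M.par_inj q ((h ζ).trans (h' ζ).symm)

lemma Rel.comp {n m : ℕ} {p q r : P} {φ ψ : CSphere → CSphere} (h : M.Rel n p q φ)
    (h' : M.Rel m q r ψ) : M.Rel (m + n) p r (ψ ∘ φ) := by
  intro ζ
  simp only [Function.comp]
  rw [h' (φ ζ), h ζ, Function.iterate_add_apply]

variable (M)

lemma exists_lift0 {p q : P} (h : M.b q = M.b p) :
    ∃ φ Φ, IsLift φ 1 Φ ∧ M.Rel 0 p q φ := M.lift0 p q h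

lemma exists_lift1 {p q : P} (h : M.b q = M.g (M.b p)) :
    ∃ φ d Φ, IsLift φ d Φ ∧ 2 ≤ d ∧ M.Rel 1 p q φ := M.lift1 p q h

lemma exists_lift (n : ℕ) (p q : P) (h : M.b q = M.g^[n] (M.b p)) :
    ∃ φ d Φ, IsLift φ d Φ ∧ 2 ^ n ≤ d ∧ M.Rel n p q φ := by
  induction n generalizing q with
  | zero =>
    obtain ⟨φ, Φ, h1, h2⟩ := M.exists_lift0 h
    exact ⟨φ, 1, Φ, h1, by simp, h2⟩
  | succ n ih =>
    obtain ⟨p', hp'⟩ := M.b_surj (M.g^[n] (M.b p))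
    obtain ⟨φ, d, Φ, h1, h2, h3⟩ := ih p' hp'
    obtain ⟨ψ, e, Ψ, k1, k2, k3⟩ := M.exists_lift1 (p := p') (q := q)
      (by rw [h, Function.iterate_succ_apply', hp'])
    refine ⟨ψ ∘ φ, d * e, Ψ ∘ Φ, k1.comp h1, ?_, ?_⟩
    · rw [pow_succ]; exact Nat.mul_le_mul h2 k2
    · rw [add_comm n 1]; exact h3.comp k3

lemma conv {α : Type*} {𝒰 : Ultrafilter α} {n : ℕ} {p q : α → P} {p₀ q₀ : P}
    {φ : α → CSphere → CSphere} {φ₀ : CSphere → CSphere}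
    (hp : Tendsto p 𝒰 (𝓝 p₀)) (hq : Tendsto q 𝒰 (𝓝 q₀))
    (hr : ∀ k, M.Rel n (p k) (q k) (φ k)) (hr₀ : M.Rel n p₀ q₀ φ₀) (hc : Continuous φ₀) :
    TendstoUniformly φ φ₀ (𝒰 : Filter α) := by
  rw [Metric.tendstoUniformly_iff]
  intro ε hε
  by_contra hne
  have h1 : ∀ᶠ k in (𝒰 : Filter α), ∃ ζ, ε ≤ dist (φ₀ ζ) (φ k ζ) := by
    have := Ultrafilter.eventually_not.2 hne
    filter_upwards [this] with k hk
    push Not at hk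
    exact hk
  have h2 : ∀ k, ∃ ζ, (∃ ζ, ε ≤ dist (φ₀ ζ) (φ k ζ)) → ε ≤ dist (φ₀ ζ) (φ k ζ) := by
    intro k
    by_cases h : ∃ ζ, ε ≤ dist (φ₀ ζ) (φ k ζ)
    · obtain ⟨ζ, h⟩ := h; exact ⟨ζ, fun _ => h⟩
    · exact ⟨CSphere.infty, fun h' => absurd h' h⟩
  choose ζ hζ using h2
  obtain ⟨ζ₀, -, hζ₀⟩ := isCompact_univ.ultrafilter_le_nhds' (𝒰.map ζ) univ_mem
  obtain ⟨η₀, -, hη₀⟩ := isCompact_univ.ultrafilter_le_nhds' (𝒰.map (fun k => φ k (ζ k))) univ_mem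
  have hζ₀ : Tendsto ζ 𝒰 (𝓝 ζ₀) := hζ₀
  have hη₀ : Tendsto (fun k => φ k (ζ k)) 𝒰 (𝓝 η₀) := hη₀
  have t1 : Tendsto (fun k => M.par (q k) (φ k (ζ k))) 𝒰 (𝓝 (M.par q₀ η₀)) :=
    (M.par_cont.tendsto (q₀, η₀)).comp (hq.prodMk_nhds hη₀)
  have t2 : Tendsto (fun k => M.f^[n] (M.par (p k) (ζ k))) 𝒰 (𝓝 (M.f^[n] (M.par p₀ ζ₀))) :=
    ((M.f_cont.iterate n).tendsto _).comp
      ((M.par_cont.tendsto (p₀, ζ₀)).comp (hp.prodMk_nhds hζ₀))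
  have t3 : M.par q₀ η₀ = M.f^[n] (M.par p₀ ζ₀) := by
    refine tendsto_nhds_unique t1 (t2.congr fun k => ?_)
    rw [hr k]
  rw [← hr₀ ζ₀] at t3
  have t4 := M.par_inj _ t3
  have t5 : Tendsto (fun k => dist (φ₀ (ζ k)) (φ k (ζ k))) 𝒰 (𝓝 (dist (φ₀ ζ₀) η₀)) :=
    ((hc.tendsto ζ₀).comp hζ₀).dist hη₀
  rw [t4, dist_self] at t5
  have t6 := t5.eventually (gt_mem_nhds hε)
  obtain ⟨k, hk1, hk2⟩ := (h1.and t6).exists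
  exact absurd hk2 (not_lt.2 (hζ k hk1))

lemma _root_.FJ.IsLift.bound {φ : CSphere → CSphere} {d : ℕ} {Φ : ℂ × ℂ → ℂ × ℂ}
    (hΦ : IsLift φ d Φ) :
    ∃ C, ∀ v, v ≠ 0 → |Real.log ‖Φ v‖ - d * Real.log ‖v‖| ≤ C := by
  have hcpt : IsCompact (sphere (0 : ℂ × ℂ) 1) := isCompact_sphere 0 1
  obtain ⟨C, hC⟩ := hcpt.exists_bound_of_continuousOn (f := fun v => Real.log ‖Φ v‖)
    (hΦ.log_cont.mono fun v hv h => by simp [h] at hv)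
  refine ⟨C, fun v hv => ?_⟩
  have hn : ‖v‖ ≠ 0 := norm_ne_zero_iff.2 hv
  have hnc : ((‖v‖ : ℂ)⁻¹) ≠ 0 := inv_ne_zero (by exact_mod_cast hn)
  have h1 := hC ((‖v‖ : ℂ)⁻¹ • v) (by
    rw [mem_sphere_zero_iff_norm, norm_smul, norm_inv, Complex.norm_real, norm_norm,
      inv_mul_cancel₀ hn])
  rw [hΦ.log_hom hnc hv, norm_inv, Complex.norm_real, norm_norm, Real.log_inv,
    Real.norm_eq_abs] at h1
  convert h1 using 2; ring

lemma bound [CompactSpace P] (n : ℕ) : ∃ C : ℝ, ∀ p q φ d Φ, M.b q = M.g^[n] (M.b p) →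
    IsLift φ d Φ → M.Rel n p q φ →
    ∃ c, ∀ v, v ≠ 0 → |Real.log ‖Φ v‖ - d * Real.log ‖v‖ - c| ≤ C := by
  by_contra hcon
  push Not at hcon
  choose p q φ d Φ hb hl hr hbad using fun k : ℕ => hcon k
  set 𝒰 : Ultrafilter ℕ := hyperfilter ℕ with h𝒰
  obtain ⟨p₀, -, hp₀⟩ := isCompact_univ.ultrafilter_le_nhds' (𝒰.map p) univ_mem
  obtain ⟨q₀, -, hq₀⟩ := isCompact_univ.ultrafilter_le_nhds' (𝒰.map q) univ_mem
  have hp₀ : Tendsto p 𝒰 (𝓝 p₀) := hp₀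
  have hq₀ : Tendsto q 𝒰 (𝓝 q₀) := hq₀
  have hb₀ : M.b q₀ = M.g^[n] (M.b p₀) := by
    refine tendsto_nhds_unique ((M.b_cont.tendsto _).comp hq₀)
      (((((M.g_cont.iterate n).comp M.b_cont).tendsto _).comp hp₀).congr fun k => ?_)
    exact (hb k).symm
  obtain ⟨φ₀, d₀, Φ₀, l₀, -, r₀⟩ := M.exists_lift n p₀ q₀ hb₀
  have hS := lemS 𝒰 (M.conv hp₀ hq₀ hr r₀ l₀.cont) hl l₀ one_pos
  obtain ⟨C₀, hC₀⟩ := l₀.bound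
  have hlarge : ∀ᶠ k : ℕ in (𝒰 : Filter ℕ), C₀ + 1 ≤ (k : ℝ) := by
    have h1 : (𝒰 : Filter ℕ) ≤ atTop := Nat.hyperfilter_le_atTop
    exact h1 (tendsto_natCast_atTop_atTop.eventually_ge_atTop (C₀ + 1))
  obtain ⟨k, ⟨hd, c, hc⟩, hk⟩ := (hS.and hlarge).exists
  obtain ⟨v, hv, hbv⟩ := hbad k c
  have h1 := hc v hv
  have h2 := hC₀ v hv
  rw [hd] at hbv
  rw [abs_le] at h1 h2
  rw [lt_abs] at hbv
  rcases hbv with h | h <;> linarith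

/-- The Green-type function. -/
def IsGreen (p : P) (C : ℝ) (G : ℂ × ℂ → ℝ) : Prop :=
  ∀ n q φ d Φ, M.b q = M.g^[n] (M.b p) → IsLift φ d Φ → M.Rel n p q φ →
    2 ^ n ≤ d ∧ ∃ c, ∀ v, v ≠ 0 → |G v - Real.log ‖Φ v‖ / d - c| ≤ C / d

/-- nested limits -/
lemma nested {A : ℕ → ℂ × ℂ → ℝ} {δ : ℕ → ℝ} (h0 : ∀ n, 0 ≤ δ n)
    (h : ∀ n v, v ≠ 0 → |A (n + 1) v - A n v| ≤ δ n - δ (n + 1)) :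
    ∃ G : ℂ × ℂ → ℝ, ∀ n v, v ≠ 0 → |G v - A n v| ≤ δ n := by
  refine ⟨fun v => ⨆ n, (A n v - δ n), fun n v hv => ?_⟩
  have hanti : Antitone fun n => A n v + δ n := antitone_nat_of_succ_le fun n => by
    have := (abs_le.1 (h n v hv)).2; linarith
  have hmono : Monotone fun n => A n v - δ n := monotone_nat_of_le_succ fun n => by
    have := (abs_le.1 (h n v hv)).1; linarith
  have hle : ∀ m n, A m v - δ m ≤ A n v + δ n := by
    intro m n
    have h1 := hmono (le_max_left m n)
    have h2 := hanti (le_max_right m n)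
    have h3 := h0 (max m n)
    linarith
  have hbdd : BddAbove (range fun n => A n v - δ n) := ⟨A n v + δ n, by
    rintro _ ⟨m, rfl⟩; exact hle m n⟩
  rw [abs_le]
  have h1 := le_ciSup hbdd n
  have h2 := ciSup_le fun m => hle m n
  constructor
  · linarith
  · linarith

lemma exists_green [CompactSpace P] : ∃ C : ℝ, 0 ≤ C ∧ ∀ p, ∃ G, M.IsGreen p C G := by
  obtain ⟨C₀, hC₀⟩ := M.bound 0
  obtain ⟨C₁, hC₁⟩ := M.bound 1
  set C := max (max C₀ C₁) 0 with hC
  have hC0 : 0 ≤ C := le_max_right _ _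
  have hCC₀ : C₀ ≤ C := (le_max_left _ _).trans (le_max_left _ _)
  have hCC₁ : C₁ ≤ C := (le_max_right _ _).trans (le_max_left _ _)
  refine ⟨2 * C + 1, by linarith, fun p => ?_⟩
  choose s hs using M.b_surj
  have hq : ∃ q : ℕ → P, ∀ n, M.b (q n) = M.g^[n] (M.b p) :=
    ⟨fun n => s (M.g^[n] (M.b p)), fun n => hs _⟩
  obtain ⟨q, hq⟩ := hq
  obtain ⟨φ₀, Φ₀, l₀, r₀⟩ := M.exists_lift0 (p := p) (q := q 0) (hq 0)
  have hstep : ∀ n, ∃ φ d Φ, IsLift φ d Φ ∧ 2 ≤ d ∧ M.Rel 1 (q n) (q (n + 1)) φ := fun n =>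
    M.exists_lift1 (by rw [hq, hq, Function.iterate_succ_apply'])
  choose ψ e Ψ hl he hr using hstep
  obtain ⟨φ, hφ0, hφs⟩ : ∃ φ : ℕ → CSphere → CSphere, φ 0 = φ₀ ∧ ∀ n, φ (n + 1) = ψ n ∘ φ n :=
    ⟨fun n => Nat.rec φ₀ (fun n φ => ψ n ∘ φ) n, rfl, fun _ => rfl⟩
  obtain ⟨D, hD0, hDs⟩ : ∃ D : ℕ → ℕ, D 0 = 1 ∧ ∀ n, D (n + 1) = D n * e n :=
    ⟨fun n => Nat.rec 1 (fun n d => d * e n) n, rfl, fun _ => rfl⟩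
  obtain ⟨Φ, hΦ0, hΦs⟩ : ∃ Φ : ℕ → ℂ × ℂ → ℂ × ℂ, Φ 0 = Φ₀ ∧ ∀ n, Φ (n + 1) = Ψ n ∘ Φ n :=
    ⟨fun n => Nat.rec Φ₀ (fun n Φ => Ψ n ∘ Φ) n, rfl, fun _ => rfl⟩
  have hL : ∀ n, IsLift (φ n) (D n) (Φ n) := by
    intro n
    induction n with
    | zero => rw [hφ0, hD0, hΦ0]; exact l₀
    | succ n ih => rw [hφs, hDs, hΦs]; exact (hl n).comp ih
  have hR : ∀ n, M.Rel n p (q n) (φ n) := by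
    intro n
    induction n with
    | zero => rw [hφ0]; exact r₀
    | succ n ih =>
      rw [hφs]
      have := ih.comp (hr n)
      rwa [add_comm 1 n] at this
  have hD : ∀ n, 2 ^ n ≤ D n := by
    intro n
    induction n with
    | zero => rw [hD0, pow_zero]
    | succ n ih => rw [hDs, pow_succ]; exact Nat.mul_le_mul ih (he n)
  have hDpos : ∀ n, (0:ℝ) < D n := fun n => by
    have : 0 < D n := lt_of_lt_of_le (by positivity) (hD n)
    exact_mod_cast this
  have hbd : ∀ n, ∃ c, ∀ v, v ≠ 0 →
      |Real.log ‖Φ (n + 1) v‖ - e n * Real.log ‖Φ n v‖ - c| ≤ C := by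
    intro n
    obtain ⟨c, hc⟩ := hC₁ _ _ _ _ _ (by rw [hq, hq, Function.iterate_succ_apply']; rfl)
      (hl n) (hr n)
    exact ⟨c, fun v hv => by rw [hΦs]; exact (hc _ ((hL n).ne v hv)).trans hCC₁⟩
  choose c hc using hbd
  let A : ℕ → ℂ × ℂ → ℝ := fun n v => Real.log ‖Φ n v‖ / D n -
    ∑ j ∈ Finset.range n, c j / D (j + 1)
  obtain ⟨G, hG⟩ := nested (A := A) (δ := fun n => C / D n)
    (fun n => div_nonneg hC0 (hDpos n).le) (by
      intro n v hv
      have hd1 := hDpos n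
      have hd2 := hDpos (n + 1)
      have hen : (2:ℝ) ≤ e n := by exact_mod_cast he n
      have hDe : (D (n + 1) : ℝ) = D n * e n := by rw [hDs]; push_cast; rfl
      have e1 : A (n + 1) v - A n v =
          (Real.log ‖Φ (n + 1) v‖ - e n * Real.log ‖Φ n v‖ - c n) / D (n + 1) := by
        simp only [A, Finset.sum_range_succ]
        rw [hDe]
        have : (e n : ℝ) ≠ 0 := by linarith
        field_simp
        ring
      rw [e1, abs_div, abs_of_pos hd2]
      have h1 : |Real.log ‖Φ (n + 1) v‖ - e n * Real.log ‖Φ n v‖ - c n| / D (n + 1) ≤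
          C / D (n + 1) := by gcongr; exact hc n v hv
      refine h1.trans ?_
      have h2 : 2 * (C / D (n + 1)) ≤ C / D n := by
        rw [mul_div_assoc', div_le_div_iff₀ hd2 hd1, hDe]
        nlinarith [mul_nonneg hC0 hd1.le]
      linarith)
  refine ⟨G, fun n q' φ' d' Φ' hb' hl' hr' => ?_⟩
  obtain ⟨τ, T, lT, rT⟩ := M.exists_lift0 (p := q n) (q := q') (by rw [hb', hq])
  have hrel : M.Rel n p q' (τ ∘ φ n) := by
    have := (hR n).comp rT
    rwa [zero_add] at this
  have hlift := lT.comp (hL n)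
  rw [hrel.unique hr', mul_one] at hlift
  obtain ⟨hdd, hu⟩ := lift_unique hl' hlift
  obtain ⟨c₁, hc₁⟩ := hu 1 one_pos
  obtain ⟨c₂, hc₂⟩ := hC₀ _ _ _ _ _ (by rw [hb', hq]; rfl) lT rT
  rw [hdd]
  refine ⟨hD n, - (∑ j ∈ Finset.range n, c j / D (j + 1)) - (c₁ + c₂) / D n, fun v hv => ?_⟩
  have h1 := hG n v hv
  have h2 := hc₁ v hv
  have h3 := hc₂ (Φ n v) ((hL n).ne v hv)
  have hd1 := hDpos n
  have e1 : G v - Real.log ‖Φ' v‖ / D n - (- (∑ j ∈ Finset.range n, c j / D (j + 1)) -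
      (c₁ + c₂) / D n) = (G v - A n v) - (Real.log ‖Φ' v‖ - Real.log ‖(T ∘ Φ n) v‖ - c₁) / D n -
      (Real.log ‖T (Φ n v)‖ - (1:ℕ) * Real.log ‖Φ n v‖ - c₂) / D n := by
    simp only [A, Function.comp]
    field_simp
    push_cast
    ring
  rw [e1]
  have h2' : |(Real.log ‖Φ' v‖ - Real.log ‖(T ∘ Φ n) v‖ - c₁) / D n| ≤ 1 / D n := by
    rw [abs_div, abs_of_pos hd1]; gcongr
  have h3' : |(Real.log ‖T (Φ n v)‖ - (1:ℕ) * Real.log ‖Φ n v‖ - c₂) / D n| ≤ C / D n := by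
    rw [abs_div, abs_of_pos hd1]; gcongr; exact h3.trans hCC₀
  have e2 : (2 * C + 1) / (D n : ℝ) = C / D n + 1 / D n + C / D n := by ring
  rw [e2]
  refine (abs_sub _ _).trans (add_le_add ((abs_sub _ _).trans (add_le_add h1 h2')) h3')

end Mdl

end FJ

namespace FJ

open InnerProductSpace

lemma exists_pow_small {C ε : ℝ} (hC : 0 ≤ C) (hε : 0 < ε) :
    ∃ n : ℕ, ∀ d : ℕ, 2 ^ n ≤ d → 0 < (d:ℝ) ∧ C / d ≤ ε := by
  obtain ⟨n, hn⟩ := pow_unbounded_of_one_lt (C / ε) (one_lt_two : (1:ℝ) < 2)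
  refine ⟨n, fun d hd => ?_⟩
  have h1 : (2:ℝ) ^ n ≤ d := by exact_mod_cast hd
  have h2 : (0:ℝ) < d := lt_of_lt_of_le (by positivity) h1
  refine ⟨h2, ?_⟩
  rw [div_le_iff₀ h2]
  rw [div_lt_iff₀ hε] at hn
  nlinarith

namespace Mdl

variable {X Y P : Type*} [MetricSpace X] [MetricSpace Y] [MetricSpace P] {M : Mdl X Y P}

lemma IsGreen.approx {p : P} {C : ℝ} {G : ℂ × ℂ → ℝ} (hC : 0 ≤ C) (hG : M.IsGreen p C G)
    {ε : ℝ} (hε : 0 < ε) : ∃ φ d Φ c, IsLift φ d Φ ∧ 0 < (d:ℝ) ∧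
      ∀ v, v ≠ 0 → |G v - Real.log ‖Φ v‖ / d - c| ≤ ε := by
  obtain ⟨n, hn⟩ := exists_pow_small hC hε
  obtain ⟨q, hq⟩ := M.b_surj (M.g^[n] (M.b p))
  obtain ⟨φ, d, Φ, h1, -, h3⟩ := M.exists_lift n p q hq
  obtain ⟨hd, c, hc⟩ := hG n q φ d Φ hq h1 h3
  exact ⟨φ, d, Φ, c, h1, (hn d hd).1, fun v hv => (hc v hv).trans (hn d hd).2⟩

lemma IsGreen.hom {p : P} {C : ℝ} {G : ℂ × ℂ → ℝ} (hC : 0 ≤ C) (hG : M.IsGreen p C G)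
    {t : ℂ} (ht : t ≠ 0) {v : ℂ × ℂ} (hv : v ≠ 0) : G (t • v) = Real.log ‖t‖ + G v := by
  have key : ∀ ε > (0:ℝ), |G (t • v) - (Real.log ‖t‖ + G v)| ≤ ε := by
    intro ε hε
    obtain ⟨φ, d, Φ, c, h1, h2, h3⟩ := hG.approx hC (half_pos hε)
    have a1 := h3 v hv
    have a2 := h3 (t • v) (smul_ne_zero ht hv)
    rw [h1.log_hom ht hv] at a2
    have : (d * Real.log ‖t‖ + Real.log ‖Φ v‖) / d = Real.log ‖t‖ + Real.log ‖Φ v‖ / d := by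
      field_simp
    rw [this] at a2
    rw [abs_le] at *
    constructor <;> linarith
  have := le_of_forall_gt_imp_ge_of_dense key
  have := abs_nonpos_iff.1 this
  linarith

lemma IsGreen.contOn {p : P} {C : ℝ} {G : ℂ × ℂ → ℝ} (hC : 0 ≤ C) (hG : M.IsGreen p C G) :
    ContinuousOn G {v | v ≠ 0} := by
  refine continuousOn_of_uniform_approx_of_continuousOn fun u hu => ?_
  obtain ⟨ε, hε, hu⟩ := Metric.mem_uniformity_dist.1 hu
  obtain ⟨φ, d, Φ, c, h1, h2, h3⟩ := hG.approx hC (half_pos hε)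
  refine ⟨fun v => Real.log ‖Φ v‖ / d + c, (h1.log_cont.div_const _).add continuousOn_const,
    fun v hv => hu ?_⟩
  have := h3 v hv
  rw [Real.dist_eq]
  rw [← sub_sub]
  linarith

variable (M)

def Fat (p : P) (ζ₀ : CSphere) : Prop :=
  ∃ r > (0:ℝ), ∀ ε > (0:ℝ), ∃ δ > (0:ℝ), ∀ n : ℕ, ∀ ζ₁ ζ₂,
    M.par p ζ₁ ∈ ball (M.par p ζ₀) r → M.par p ζ₂ ∈ ball (M.par p ζ₀) r →
    dist (M.par p ζ₁) (M.par p ζ₂) < δ →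
    dist (M.f^[n] (M.par p ζ₁)) (M.f^[n] (M.par p ζ₂)) < ε

lemma par_cont1 (p : P) : Continuous (M.par p) :=
  M.par_cont.comp (continuous_const.prodMk continuous_id)

/-- quantitative injectivity on compact sets -/
lemma _root_.FJ.inj_cpt {A Z : Type*} [TopologicalSpace A] [MetricSpace Z] {S : Set A}
    (hS : IsCompact S) {u w : A → Z} (hu : ContinuousOn u S) (hw : ContinuousOn w S)
    (hne : ∀ a ∈ S, u a ≠ w a) : ∃ δ > (0:ℝ), ∀ a ∈ S, δ ≤ dist (u a) (w a) := by
  rcases S.eq_empty_or_nonempty with rfl | hnon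
  · exact ⟨1, one_pos, by simp⟩
  obtain ⟨a₀, ha₀, hm⟩ := hS.exists_isMinOn (f := fun a => dist (u a) (w a)) hnon
    (continuous_dist.comp_continuousOn (ContinuousOn.prodMk hu hw))
  exact ⟨dist (u a₀) (w a₀), dist_pos.2 (hne a₀ ha₀), fun a ha => hm ha⟩

lemma _root_.FJ.harm_ball {u : ℂ → ℝ} {z : ℂ} (h : HarmonicAt u z) :
    ∃ R > (0:ℝ), ∃ F : ℂ → ℂ, DifferentiableOn ℂ F (ball z R) ∧ ∀ w ∈ ball z R, u w = (F w).re := by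
  obtain ⟨R, hR, hsub⟩ := Metric.mem_nhds_iff.1 h.eventually
  have : HarmonicOnNhd u (ball z R) := fun w hw => hsub hw
  obtain ⟨F, hF, hFe⟩ := this.exists_analyticOnNhd_ball_re_eq
  exact ⟨R, hR, F, hF.differentiableOn, fun w hw => (hFe hw).symm⟩

variable {M}

lemma harm_of_fat [CompactSpace P] {p : P} {C : ℝ} {G : ℂ × ℂ → ℝ} (hC : 0 ≤ C)
    (hG : M.IsGreen p C G) {s : Bool} {z₀ : ℂ} (h : M.Fat p (pr (sec s z₀))) :
    HarmonicAt (fun z => G (sec s z)) z₀ := by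
  obtain ⟨r, hr, hF⟩ := h
  have hε₀ : ∀ t : Bool, ∃ ε > (0:ℝ), ∀ q ζ₁ ζ₂, dist (M.par q ζ₁) (M.par q ζ₂) < ε →
      |rho t ζ₁ - rho t ζ₂| < 1 / 2 := by
    intro t
    have hcl : IsClosed {a : P × CSphere × CSphere | 1 / 2 ≤ |rho t a.2.1 - rho t a.2.2|} := by
      have := rho_cont t
      exact isClosed_le continuous_const (by fun_prop)
    obtain ⟨δ, hδ, h⟩ := inj_cpt hcl.isCompact
      (u := fun a : P × CSphere × CSphere => M.par a.1 a.2.1) (w := fun a => M.par a.1 a.2.2)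
      (M.par_cont.comp (continuous_fst.prodMk (continuous_fst.comp continuous_snd))).continuousOn
      (M.par_cont.comp (continuous_fst.prodMk (continuous_snd.comp continuous_snd))).continuousOn
      (by
        intro a ha heq
        have := M.par_inj _ heq
        simp only [mem_ofPred_eq, this, sub_self, abs_zero] at ha
        norm_num at ha)
    refine ⟨δ, hδ, fun q ζ₁ ζ₂ hd => ?_⟩
    by_contra hcon
    exact absurd hd (not_lt.2 (h (q, ζ₁, ζ₂) (not_lt.1 hcon)))
  obtain ⟨e0, he0, H0⟩ := hε₀ false
  obtain ⟨e1, he1, H1⟩ := hε₀ true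
  obtain ⟨δ, hδ, hF⟩ := hF (min e0 e1) (lt_min he0 he1)
  have hcz : Continuous fun z => M.par p (pr (sec s z)) := (M.par_cont1 p).comp (pr_sec_cont s)
  obtain ⟨R, hR, hball⟩ := Metric.mem_nhds_iff.1 (hcz.continuousAt.preimage_mem_nhds
    (ball_mem_nhds (M.par p (pr (sec s z₀))) (lt_min hr hδ)))
  refine harm_limit hR (fun ε hε => ?_) z₀ (mem_ball_self (by linarith))
  have hl2 : 0 < Real.log 2 := Real.log_pos one_lt_two
  obtain ⟨n, hn⟩ := exists_pow_small (C := C + Real.log 2) (by linarith) hε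
  obtain ⟨q, hq⟩ := M.b_surj (M.g^[n] (M.b p))
  obtain ⟨φ, d, Φ, l, -, hr'⟩ := M.exists_lift n p q hq
  obtain ⟨hd, c, hc⟩ := hG n q φ d Φ hq l hr'
  obtain ⟨hd0, hd1⟩ := hn d hd
  obtain ⟨t, ht⟩ := exists_rho (φ (pr (sec s z₀)))
  have hlow : ∀ z ∈ ball z₀ R, 1 / 2 < rho t (φ (pr (sec s z))) := by
    intro z hz
    have hz' := hball hz
    simp only [mem_preimage, mem_ball, lt_min_iff] at hz'
    have h1 := hF n (pr (sec s z)) (pr (sec s z₀)) hz'.1 (mem_ball_self hr) hz'.2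
    rw [← hr', ← hr', lt_min_iff] at h1
    have h2 : |rho t (φ (pr (sec s z))) - rho t (φ (pr (sec s z₀)))| < 1 / 2 := by
      cases t
      · exact H0 _ _ _ h1.1
      · exact H1 _ _ _ h1.2
    rw [ht, abs_lt] at h2
    linarith
  obtain ⟨h, hhd, hhe⟩ := lift_logre l (s := s) (t := t) (c := z₀) (r := R)
    (fun z hz => by linarith [hlow z hz])
  refine ⟨fun z => (h z / d + c).re, harm_re ((hhd.div_const _).add_const _), fun z hz => ?_⟩
  have h1 := hc (sec s z) (sec_ne _ _)
  rw [hhe z hz] at h1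
  have hle1 : rho t (φ (pr (sec s z))) ≤ 1 := by
    rw [← l.spec _ (sec_ne _ _), rho_pr t (l.ne _ (sec_ne _ _))]
    exact div_le_one_of_le₀ (norm_co_le _ _) (norm_nonneg _)
  have h2 : Real.log (rho t (φ (pr (sec s z)))) ≤ 0 :=
    Real.log_nonpos (by linarith [hlow z hz]) hle1
  have h3 : - Real.log 2 ≤ Real.log (rho t (φ (pr (sec s z)))) := by
    rw [← Real.log_inv]
    exact Real.log_le_log (by norm_num) (by linarith [hlow z hz])
  have e1 : (h z / d + c).re = (h z).re / d + c := by
    rw [Complex.add_re, Complex.ofReal_re]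
    congr 1
    exact Complex.div_natCast_re _ _
  beta_reduce
  rw [e1]
  have e2 : G (sec s z) - ((h z).re / d + c) = (G (sec s z) - ((h z).re -
      Real.log (rho t (φ (pr (sec s z))))) / d - c) - Real.log (rho t (φ (pr (sec s z)))) / d := by
    ring
  rw [e2]
  refine (abs_sub _ _).trans ((add_le_add h1 ?_).trans ((add_div C (Real.log 2) d).ge.trans hd1))
  rw [abs_div, abs_of_pos hd0]
  gcongr
  rw [abs_le]; constructor <;> linarith

lemma fat_of_harm [CompactSpace P] {p : P} {C : ℝ} {G : ℂ × ℂ → ℝ} (hC : 0 ≤ C)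
    (hG : M.IsGreen p C G) {s : Bool} {z₀ : ℂ} (h : HarmonicAt (fun z => G (sec s z)) z₀) :
    M.Fat p (pr (sec s z₀)) := by
  obtain ⟨R, hR, F, hFd, hFe⟩ := harm_ball h
  -- the neighbourhood
  have hemb : IsEmbedding (M.par p) :=
    (Continuous.isClosedEmbedding (M.par_cont1 p) (M.par_inj p)).isEmbedding
  have hN : ∀ᶠ ζ in 𝓝 (pr (sec s z₀)), pr (sec s (tau s ζ)) = ζ ∧ tau s ζ ∈ ball z₀ (R / 2) := by
    refine (pr_sec_tau_ev s z₀).and ((tau_contAt s z₀).preimage_mem_nhds ?_)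
    rw [tau_pr_sec]
    exact ball_mem_nhds _ (by linarith)
  rw [hemb.nhds_eq_comap] at hN
  obtain ⟨V, hV, hVsub⟩ := Filter.mem_comap.1 hN
  obtain ⟨r, hr, hrV⟩ := Metric.mem_nhds_iff.1 hV
  refine ⟨r, hr, fun ε hε => ?_⟩
  -- uniform continuity
  set An : Set (ℂ × ℂ) := {v | Real.exp (-C) ≤ ‖v‖ ∧ ‖v‖ ≤ Real.exp C} with hAn
  have hAncpt : IsCompact An := by
    have : An = closedBall 0 (Real.exp C) ∩ {v | Real.exp (-C) ≤ ‖v‖} := by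
      ext v; simp [hAn, and_comm]
    rw [this]
    exact (isCompact_closedBall _ _).inter_right (isClosed_le continuous_const continuous_norm)
  have hAnne : ∀ v ∈ An, v ≠ 0 := by
    rintro v hv rfl
    have := hv.1
    rw [norm_zero] at this
    linarith [Real.exp_pos (-C)]
  have hUC : UniformContinuousOn (fun a : P × (ℂ × ℂ) => M.par a.1 (pr a.2)) (univ ×ˢ An) := by
    refine (isCompact_univ.prod hAncpt).uniformContinuousOn_of_continuous ?_
    refine M.par_cont.comp_continuousOn (continuousOn_fst.prodMk
      (pr_contOn.comp continuousOn_snd fun a ha => hAnne _ ha.2))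
  obtain ⟨η, hη, hUC⟩ := Metric.uniformContinuousOn_iff.1 hUC ε hε
  set K : ℝ := Real.exp C / (R / 4) with hK
  have hK0 : 0 < K := div_pos (Real.exp_pos _) (by linarith)
  -- quantitative injectivity
  obtain ⟨δ, hδ, hinj⟩ := inj_cpt
    (S := {a : ℂ × ℂ | η / K ≤ dist a.1 a.2} ∩ closedBall z₀ (R / 2) ×ˢ closedBall z₀ (R / 2))
    (((isCompact_closedBall _ _).prod (isCompact_closedBall _ _)).inter_left
      (isClosed_le continuous_const continuous_dist))
    (u := fun a => M.par p (pr (sec s a.1))) (w := fun a => M.par p (pr (sec s a.2)))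
    (((M.par_cont1 p).comp (pr_sec_cont s)).comp continuous_fst).continuousOn
    (((M.par_cont1 p).comp (pr_sec_cont s)).comp continuous_snd).continuousOn
    (by
      rintro a ⟨ha, -⟩ heq
      have := congrArg (tau s) (M.par_inj _ heq)
      rw [tau_pr_sec, tau_pr_sec] at this
      rw [mem_ofPred_eq, this, dist_self] at ha
      exact absurd ha (not_le.2 (div_pos hη hK0)))
  refine ⟨δ, hδ, fun n ζ₁ ζ₂ h1 h2 h12 => ?_⟩
  obtain ⟨hz1, hb1⟩ := hVsub (hrV h1)
  obtain ⟨hz2, hb2⟩ := hVsub (hrV h2)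
  set z₁ := tau s ζ₁
  set z₂ := tau s ζ₂
  have hdz : dist z₁ z₂ < η / K := by
    by_contra hcon
    have := hinj (z₁, z₂) ⟨not_lt.1 hcon, ball_subset_closedBall hb1, ball_subset_closedBall hb2⟩
    simp only [hz1, hz2] at this
    linarith
  obtain ⟨q, hq⟩ := M.b_surj (M.g^[n] (M.b p))
  obtain ⟨φ, d, Φ, l, hd2, hr'⟩ := M.exists_lift n p q hq
  obtain ⟨hd, c, hc⟩ := hG n q φ d Φ hq l hr'
  have hd0 : (0:ℝ) < d := by
    have : 0 < d := lt_of_lt_of_le (by positivity) hd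
    exact_mod_cast this
  set w : ℂ → ℂ × ℂ := fun z => ((Real.exp (c * d) : ℝ) : ℂ) • Φ (Complex.exp (- F z) • sec s z) with hw
  have hE : ((Real.exp (c * d) : ℝ) : ℂ) ≠ 0 := by exact_mod_cast (Real.exp_pos _).ne'
  have hsne : ∀ z, Complex.exp (- F z) • sec s z ≠ 0 := fun z =>
    smul_ne_zero (Complex.exp_ne_zero _) (sec_ne _ _)
  have hwd : DifferentiableOn ℂ w (ball z₀ R) := by
    have h0 : DifferentiableOn ℂ (fun z => Φ (Complex.exp (- F z) • sec s z)) (ball z₀ R) :=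
      l.diff.comp_differentiableOn ((hFd.neg.cexp).smul (sec_diff s).differentiableOn)
    exact h0.const_smul (((Real.exp (c * d) : ℝ)) : ℂ)
  have hwA : ∀ z ∈ ball z₀ R, w z ∈ An := by
    intro z hz
    have h1 := hc _ (hsne z)
    rw [hG.hom hC (Complex.exp_ne_zero _) (sec_ne _ _), Complex.norm_exp, Real.log_exp,
      hFe z hz, Complex.neg_re, neg_add_cancel] at h1
    have hpos : 0 < ‖Φ (Complex.exp (- F z) • sec s z)‖ := norm_pos_iff.2 (l.ne _ (hsne z))
    have h2 : |c * d + Real.log ‖Φ (Complex.exp (- F z) • sec s z)‖| ≤ C := by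
      have e : c * d + Real.log ‖Φ (Complex.exp (- F z) • sec s z)‖ =
        - ((0 - Real.log ‖Φ (Complex.exp (- F z) • sec s z)‖ / d - c) * d) := by
        field_simp; ring
      rw [e, abs_neg, abs_mul, abs_of_pos hd0]
      calc _ ≤ C / d * d := by gcongr
        _ = C := by field_simp
    have e2 : ‖w z‖ = Real.exp (c * d + Real.log ‖Φ (Complex.exp (- F z) • sec s z)‖) := by
      rw [Real.exp_add, Real.exp_log hpos, hw]
      simp only
      rw [norm_smul, Complex.norm_real, Real.norm_eq_abs, abs_of_pos (Real.exp_pos _)]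
    rw [abs_le] at h2
    refine ⟨?_, ?_⟩
    · rw [e2]; exact Real.exp_le_exp.2 h2.1
    · rw [e2]; exact Real.exp_le_exp.2 h2.2
  have hwpr : ∀ z, pr (w z) = φ (pr (sec s z)) := by
    intro z
    rw [hw]
    simp only
    rw [pr_smul hE, l.spec _ (hsne z), pr_smul (Complex.exp_ne_zero _)]
  have hLip : ‖w z₁ - w z₂‖ ≤ K * ‖z₁ - z₂‖ := by
    refine Convex.norm_image_sub_le_of_norm_deriv_le (𝕜 := ℂ) (s := ball z₀ (R / 2)) ?_ ?_
      (convex_ball _ _) hb2 hb1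
    · intro z hz
      exact hwd.differentiableAt (isOpen_ball.mem_nhds (ball_subset_ball (by linarith) hz))
    · intro z hz
      have hsub : closedBall z (R / 4) ⊆ ball z₀ R := by
        intro x hx
        rw [mem_ball] at hz ⊢
        rw [mem_closedBall] at hx
        linarith [dist_triangle x z z₀]
      refine Complex.norm_deriv_le_of_forall_mem_sphere_norm_le (by linarith) ?_ ?_
      · refine DifferentiableOn.diffContOnCl ?_
        rw [closure_ball _ (by linarith)]
        exact hwd.mono hsub
      · intro x hx
        exact (hwA x (hsub (sphere_subset_closedBall hx))).2
  have hdw : dist (w z₁) (w z₂) < η := by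
    rw [dist_eq_norm]
    refine hLip.trans_lt ?_
    rw [dist_eq_norm, lt_div_iff₀ hK0] at hdz
    linarith
  have hin : ∀ {z}, z ∈ ball z₀ (R / 2) → z ∈ ball z₀ R := fun hz =>
    ball_subset_ball (by linarith) hz
  have := hUC (q, w z₁) ⟨mem_univ _, hwA _ (hin hb1)⟩ (q, w z₂) ⟨mem_univ _, hwA _ (hin hb2)⟩
    (by rw [Prod.dist_eq]; exact max_lt (by simpa using hη) hdw)
  simp only [hwpr, hz1, hz2] at this
  rwa [hr', hr'] at this

lemma exists_not_fat [CompactSpace P] (M : Mdl X Y P) (p : P) : ∃ ζ, ¬ M.Fat p ζ := by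
  obtain ⟨C, hC, hG⟩ := M.exists_green
  obtain ⟨G, hG⟩ := hG p
  by_contra hcon
  push Not at hcon
  have := L1 (pure () : Ultrafilter Unit) (fun _ => G) (fun _ => 1) (fun _ => hG.contOn hC)
    (fun _ t v ht hv => by rw [hG.hom hC ht hv]; simp) (by
      intro s z₀
      obtain ⟨R, hR, F, hFd, hFe⟩ := harm_ball (harm_of_fat hC hG (hcon (pr (sec s z₀))))
      refine ⟨R, hR, fun ε hε => Eventually.of_forall fun _ => ⟨F, hFd, fun z hz => ?_⟩⟩
      have := hFe z hz
      beta_reduce at this ⊢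
      rw [this]; simp [hε.le]) one_pos
  simp at this

/-- no isolated points -/
lemma not_isolated [CompactSpace P] (M : Mdl X Y P) (p : P) {ζ₀ : CSphere} (h : ¬ M.Fat p ζ₀) :
    ∃ᶠ ζ in 𝓝[≠] ζ₀, ¬ M.Fat p ζ := by
  obtain ⟨C, hC, hG⟩ := M.exists_green
  obtain ⟨G, hG⟩ := hG p
  intro hev
  simp only [not_not] at hev
  apply h
  obtain ⟨s, z₀, -, rfl⟩ := exists_sec ζ₀
  refine fat_of_harm hC hG ?_
  rw [eventually_nhdsWithin_iff] at hev
  have h2 := (pr_sec_cont s).continuousAt.eventually hev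
  obtain ⟨R, hR, hball⟩ := Metric.mem_nhds_iff.1 h2
  refine harm_removable (r := R) ?_ ?_ z₀ (mem_ball_self hR)
  · exact ((hG.contOn hC).continuousAt (isOpen_ne.mem_nhds (sec_ne s z₀))).comp
      (sec_diff s).continuous.continuousAt
  · intro z hz hne
    refine harm_of_fat hC hG (hball hz ?_)
    intro heq
    apply hne
    have := congrArg (tau s) heq
    rwa [tau_pr_sec, tau_pr_sec] at this

/-- semicontinuity -/
lemma fat_limit [CompactSpace P] (M : Mdl X Y P) {α : Type*} (𝒰 : Ultrafilter α) {p : α → P}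
    {p₀ : P} (hp : Tendsto p 𝒰 (𝓝 p₀)) {ζ₀ : CSphere} {N : Set CSphere} (hN : N ∈ 𝓝 ζ₀)
    (hF : ∀ᶠ k in (𝒰 : Filter α), ∀ ζ ∈ N, M.Fat (p k) ζ) : M.Fat p₀ ζ₀ := by
  obtain ⟨C, hC, hG⟩ := M.exists_green
  choose G hG using hG
  obtain ⟨s, z₀, -, rfl⟩ := exists_sec ζ₀
  refine fat_of_harm hC (hG p₀) ?_
  obtain ⟨R, hR, hball⟩ := Metric.mem_nhds_iff.1 ((pr_sec_cont s).continuousAt.preimage_mem_nhds hN)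
  refine harm_limit hR (fun ε hε => ?_) z₀ (mem_ball_self (by linarith))
  obtain ⟨n, hn⟩ := exists_pow_small (C := 2 * C + 1) (by linarith) hε
  choose q hq using fun k => M.b_surj (M.g^[n] (M.b (p k)))
  obtain ⟨q₀, -, hq₀⟩ := isCompact_univ.ultrafilter_le_nhds' (𝒰.map q) univ_mem
  have hq₀ : Tendsto q 𝒰 (𝓝 q₀) := hq₀
  have hb₀ : M.b q₀ = M.g^[n] (M.b p₀) := by
    refine tendsto_nhds_unique ((M.b_cont.tendsto _).comp hq₀)
      (((((M.g_cont.iterate n).comp M.b_cont).tendsto _).comp hp).congr fun k => ?_)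
    exact (hq k).symm
  choose φ d Φ l _ hr using fun k => M.exists_lift n (p k) (q k) (hq k)
  obtain ⟨φ₀, d₀, Φ₀, l₀, -, r₀⟩ := M.exists_lift n p₀ q₀ hb₀
  have hS := lemS 𝒰 (M.conv hp hq₀ hr r₀ l₀.cont) l l₀ one_pos
  obtain ⟨k, ⟨hdk, c, hc⟩, hFk⟩ := (hS.and hF).exists
  obtain ⟨hd, c₁, hc₁⟩ := hG (p k) n (q k) _ _ _ (hq k) (l k) (hr k)
  obtain ⟨-, c₀, hc₀⟩ := hG p₀ n q₀ _ _ _ hb₀ l₀ r₀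
  rw [hdk] at hc₁ hd
  obtain ⟨hd0, hdε⟩ := hn d₀ hd
  refine ⟨fun z => G (p k) (sec s z) - (c₁ + c / d₀ - c₀), ?_, ?_⟩
  · have h1 : HarmonicOnNhd (fun z => G (p k) (sec s z)) (ball z₀ R) := fun z hz =>
      harm_of_fat hC (hG (p k)) (hFk _ (hball hz))
    have h2 : HarmonicOnNhd (fun _ : ℂ => (c₁ + c / d₀ - c₀)) (ball z₀ R) := fun z hz =>
      harmonicAt_const _
    intro z hz
    exact (h1 z hz).sub (h2 z hz)
  · intro z hz
    have a1 := hc₁ (sec s z) (sec_ne _ _)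
    have a0 := hc₀ (sec s z) (sec_ne _ _)
    have a2 := hc (sec s z) (sec_ne _ _)
    have a2' : |(Real.log ‖Φ k (sec s z)‖ - Real.log ‖Φ₀ (sec s z)‖ - c) / d₀| ≤ 1 / d₀ := by
      rw [abs_div, abs_of_pos hd0]; gcongr
    have e1 : G p₀ (sec s z) - (G (p k) (sec s z) - (c₁ + c / d₀ - c₀)) =
        (G p₀ (sec s z) - Real.log ‖Φ₀ (sec s z)‖ / d₀ - c₀) -
        (G (p k) (sec s z) - Real.log ‖Φ k (sec s z)‖ / d₀ - c₁) -
        (Real.log ‖Φ k (sec s z)‖ - Real.log ‖Φ₀ (sec s z)‖ - c) / d₀ + 2 * c₀ - 2 * c₀ := by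
      ring
    have e2 : (2 * C + 1) / (d₀:ℝ) = C / d₀ + C / d₀ + 1 / d₀ := by ring
    rw [e1, add_sub_cancel_right]
    rw [e2] at hdε
    refine ((abs_sub _ _).trans (add_le_add ((abs_sub _ _).trans (add_le_add a0 a1)) a2')).trans hdε

end Mdl

end FJ

namespace FJ

lemma ratDeg_lift {φ : CSphere → CSphere} {n : ℕ} (h : CSphere.ratDegEq φ n) :
    ∃ Φ, IsLift φ n Φ := by
  obtain ⟨p, q, ⟨hq, hpq, rfl⟩, rfl⟩ := h
  exact ⟨_, ratLift_lift hq hpq⟩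

lemma param_coord {X Y : Type*} [TopologicalSpace X] [TopologicalSpace Y] {proj : Y → X}
    {U : Set X} (T : CSphereTriv proj U) {x : X} (hx : x ∈ U) {y : Y} (hy : proj y ∈ U)
    (hyx : proj y = x) : T.param x hx (T.coord y hy) = y := by
  subst hyx
  have h1 : T.equiv (T.equiv.symm ⟨y, hy⟩) = ⟨y, hy⟩ := T.equiv.apply_symm_apply _
  have h2 := T.fiber_eq (T.equiv.symm ⟨y, hy⟩).1 (T.equiv.symm ⟨y, hy⟩).2
  rw [Prod.mk.eta, h1] at h2
  have h3 : (⟨proj y, hx⟩ : U) = (T.equiv.symm ⟨y, hy⟩).1 := Subtype.ext h2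
  unfold CSphereTriv.param CSphereTriv.coord
  rw [h3, Prod.mk.eta, h1]

lemma param_inj {X Y : Type*} [TopologicalSpace X] [TopologicalSpace Y] {proj : Y → X}
    {U : Set X} (T : CSphereTriv proj U) {x : X} (hx : x ∈ U) :
    Function.Injective (T.param x hx) := by
  intro a b h
  have := T.equiv.injective (Subtype.ext h)
  exact (Prod.ext_iff.1 this).2

section build

variable {X Y : Type*} [MetricSpace X] [MetricSpace Y] [CompactSpace X]

lemma exists_mdl (F : FRM X Y) (hdeg : ∀ x : X, F.toPreFRM.degGe x 2) :
    ∃ (t : Set (X × X)) (M : Mdl X Y t), CompactSpace t ∧ M.f = F.f ∧ M.g = F.g ∧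
      (∀ p, range (M.par p) = F.toPreFRM.fiber (M.b p)) := by
  have h0 : ∀ a : X, ∃ (i : F.ι) (r : ℝ), 0 < r ∧ closedBall a r ⊆ F.U i := by
    intro a
    obtain ⟨i, hi⟩ := F.U_cover a
    obtain ⟨r, hr, h⟩ := Metric.nhds_basis_closedBall.mem_iff.1 ((F.U_open i).mem_nhds hi)
    exact ⟨i, r, hr, h⟩
  choose i r hr hsub using h0
  obtain ⟨t, -, ht⟩ := isCompact_univ.elim_nhds_subcover (fun a : X => ball a (r a))
    (fun a _ => ball_mem_nhds a (hr a))
  set P : Set (X × X) := {p | p.1 ∈ t ∧ p.2 ∈ closedBall p.1 (r p.1)} with hP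
  have hU : ∀ p : P, p.1.2 ∈ F.U (i p.1.1) := fun p => hsub _ p.2.2
  have hcpt : IsCompact P := by
    have : P = ⋃ a ∈ t, ({a} : Set X) ×ˢ closedBall a (r a) := by
      ext p
      simp only [hP, mem_ofPred_eq, mem_iUnion, mem_prod, mem_singleton_iff, exists_prop]
      constructor
      · rintro ⟨h1, h2⟩; exact ⟨p.1, h1, rfl, h2⟩
      · rintro ⟨a, h1, rfl, h2⟩; exact ⟨h1, h2⟩
    rw [this]
    exact t.isCompact_biUnion fun a _ => isCompact_singleton.prod isClosed_closedBall.isCompact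
  let par : P → CSphere → Y := fun p ζ => (F.triv (i p.1.1)).param p.1.2 (hU p) ζ
  have hparproj : ∀ p ζ, F.proj (par p ζ) = p.1.2 := fun p ζ => (F.triv _).proj_param _ _ _
  have parcont : Continuous (Function.uncurry par) := by
    let u : P → t := fun p => ⟨p.1.1, p.2.1⟩
    have hu : Continuous u := (continuous_fst.comp continuous_subtype_val).subtype_mk _
    rw [continuous_iff_continuousAt]
    rintro ⟨p, ζ⟩
    have hS : IsOpen ((fun q : P × CSphere => u q.1) ⁻¹' {u p}) :=
      (isOpen_discrete _).preimage (hu.comp continuous_fst)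
    refine ContinuousOn.continuousAt ?_ (hS.mem_nhds rfl)
    rw [continuousOn_iff_continuous_domRestrict]
    have hUS : ∀ q : ((fun q : P × CSphere => u q.1) ⁻¹' {u p}), q.1.1.1.2 ∈ F.U (i p.1.1) := by
      rintro ⟨q, hq⟩
      have : q.1.1.1 = p.1.1 := congrArg Subtype.val hq
      have h2 := hU q.1
      rwa [this] at h2
    have heq : (((fun q : P × CSphere => u q.1) ⁻¹' {u p}).domRestrict (Function.uncurry par)) =
        fun q => (((F.triv (i p.1.1)).equiv (⟨q.1.1.1.2, hUS q⟩, q.1.2) : _) : Y) := by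
      funext ⟨q, hq⟩
      have : q.1.1.1 = p.1.1 := congrArg Subtype.val hq
      have key : ∀ (a a' : X) (x : X) (h : x ∈ F.U (i a)) (h' : x ∈ F.U (i a')), a = a' →
          (F.triv (i a)).param x h q.2 = (F.triv (i a')).param x h' q.2 := by
        rintro a a' x h h' rfl; rfl
      exact key _ _ _ _ _ this
    rw [heq]
    refine continuous_subtype_val.comp ((F.triv (i p.1.1)).equiv.continuous.comp ?_)
    refine Continuous.prodMk (Continuous.subtype_mk ?_ _) (continuous_snd.comp continuous_subtype_val)
    exact continuous_snd.comp (continuous_subtype_val.comp (continuous_fst.comp continuous_subtype_val))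
  have trans : ∀ (k l : F.ι) (x : X) (hk : x ∈ F.U k) (hl : x ∈ F.U l) (ζ : CSphere),
      (F.triv l).param x hl (F.conjTrans k l x hk hl ζ) = (F.triv k).param x hk ζ := by
    intro k l x hk hl ζ
    exact param_coord _ _ _ ((F.triv k).proj_param _ _ _)
  let M : Mdl X Y P :=
    { f := F.f
      f_cont := F.f_cont
      g := F.g
      g_cont := F.g_cont
      b := fun p => p.1.2
      b_cont := continuous_snd.comp continuous_subtype_val
      b_surj := by
        intro x
        have := ht (mem_univ x)
        simp only [mem_iUnion, exists_prop] at this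
        obtain ⟨a, ha, hx⟩ := this
        exact ⟨⟨(a, x), ha, ball_subset_closedBall hx⟩, rfl⟩
      par := par
      par_cont := parcont
      par_inj := fun p => param_inj _ _
      lift0 := by
        intro p q hpq
        have hq : p.1.2 ∈ F.U (i q.1.1) := by
          have := hU q
          rwa [hpq] at this
        obtain ⟨Φ, hΦ⟩ := ratDeg_lift (F.mobius (i p.1.1) (i q.1.1) p.1.2 (hU p) hq)
        refine ⟨_, Φ, hΦ, fun ζ => ?_⟩
        exact param_coord _ _ _ (((F.triv _).proj_param _ _ _).trans hpq.symm)
      lift1 := by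
        intro p q hpq
        have hq : F.g p.1.2 ∈ F.U (i q.1.1) := by
          have := hU q
          rwa [hpq] at this
        obtain ⟨k, l, hk, hl, P₁, Q₁, ⟨hQ, hcop, he⟩, hd⟩ := hdeg p.1.2
        obtain ⟨Φ₂, h2⟩ := ratDeg_lift (⟨P₁, Q₁, ⟨hQ, hcop, he⟩, rfl⟩ :
          CSphere.ratDegEq (F.conjMap k l p.1.2 hk hl) (max P₁.natDegree Q₁.natDegree))
        obtain ⟨Φ₁, h1⟩ := ratDeg_lift (F.mobius (i p.1.1) k p.1.2 (hU p) hk)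
        obtain ⟨Φ₃, h3⟩ := ratDeg_lift (F.mobius l (i q.1.1) (F.g p.1.2) hl hq)
        refine ⟨_, _, _, h3.comp (h2.comp h1), by simpa using hd, fun ζ => ?_⟩
        have e1 : par q (F.conjTrans l (i q.1.1) (F.g p.1.2) hl hq
            (F.conjMap k l p.1.2 hk hl (F.conjTrans (i p.1.1) k p.1.2 (hU p) hk ζ))) =
            (F.triv l).param _ hl (F.conjMap k l p.1.2 hk hl
              (F.conjTrans (i p.1.1) k p.1.2 (hU p) hk ζ)) :=
          param_coord _ _ _ (((F.triv _).proj_param _ _ _).trans hpq.symm)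
        have e2 : (F.triv l).param _ hl (F.conjMap k l p.1.2 hk hl
              (F.conjTrans (i p.1.1) k p.1.2 (hU p) hk ζ)) =
              F.f ((F.triv k).param _ hk (F.conjTrans (i p.1.1) k p.1.2 (hU p) hk ζ)) :=
          param_coord _ _ _ (by rw [F.semiconj, (F.triv k).proj_param])
        exact e1.trans (e2.trans (congrArg F.f (trans _ _ _ _ _ _))) }
  refine ⟨P, M, isCompact_iff_compactSpace.1 hcpt, rfl, rfl, fun p => ?_⟩
  ext y
  constructor
  · rintro ⟨ζ, rfl⟩
    exact hparproj p ζ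
  · intro hy
    have hy' : F.proj y = p.1.2 := hy
    exact ⟨(F.triv (i p.1.1)).coord y (by rw [hy']; exact hU p), param_coord _ _ _ hy'⟩

lemma julia_facts (F : FRM X Y) (hdeg : ∀ x : X, F.toPreFRM.degGe x 2) :
    (∀ x, (F.toPreFRM.julia x).Nonempty) ∧ (∀ x, IsClosed (F.toPreFRM.julia x)) ∧
    (∀ x, Preperfect (F.toPreFRM.julia x)) ∧
    (∀ V : Set Y, IsOpen V → IsOpen {x | (V ∩ F.toPreFRM.julia x).Nonempty}) := by
  obtain ⟨P, M, hcpt, hf, hg, hrange⟩ := exists_mdl F hdeg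
  have hproj : ∀ p ζ, F.proj (M.par p ζ) = M.b p := by
    intro p ζ
    have : M.par p ζ ∈ F.toPreFRM.fiber (M.b p) := by rw [← hrange]; exact mem_range_self _
    exact this
  have hfat : ∀ p ζ, M.par p ζ ∈ F.toPreFRM.fatou (M.b p) ↔ M.Fat p ζ := by
    intro p ζ
    constructor
    · rintro ⟨-, r, hr, h⟩
      refine ⟨r, hr, fun ε hε => ?_⟩
      obtain ⟨δ, hδ, h⟩ := h ε hε
      refine ⟨δ, hδ, fun n ζ₁ ζ₂ h1 h2 hd => ?_⟩
      rw [hf]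
      exact h n _ ⟨hproj _ _, h1⟩ _ ⟨hproj _ _, h2⟩ hd
    · rintro ⟨r, hr, h⟩
      refine ⟨hproj p ζ, r, hr, fun ε hε => ?_⟩
      obtain ⟨δ, hδ, h⟩ := h ε hε
      refine ⟨δ, hδ, ?_⟩
      rintro n y₁ ⟨h1, h1'⟩ y₂ ⟨h2, h2'⟩ hd
      rw [← hrange] at h1 h2
      obtain ⟨ζ₁, rfl⟩ := h1
      obtain ⟨ζ₂, rfl⟩ := h2
      rw [hf] at h
      exact h n _ _ h1' h2' hd
  have hjul : ∀ p ζ, M.par p ζ ∈ F.toPreFRM.julia (M.b p) ↔ ¬ M.Fat p ζ := by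
    intro p ζ
    rw [← hfat]
    exact ⟨fun h => h.2, fun h => ⟨hproj _ _, h⟩⟩
  have hex : ∀ p, ∀ y ∈ F.toPreFRM.julia (M.b p), ∃ ζ, M.par p ζ = y := by
    intro p y hy
    have : y ∈ range (M.par p) := by rw [hrange]; exact hy.1
    exact this
  refine ⟨?_, ?_, ?_, ?_⟩
  · intro x
    obtain ⟨p, rfl⟩ := M.b_surj x
    obtain ⟨ζ, hζ⟩ := M.exists_not_fat p
    exact ⟨_, (hjul p ζ).2 hζ⟩
  · intro x
    refine isClosed_of_closure_subset fun y hy => ?_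
    have hyx : F.proj y = x := by
      have hc : IsClosed (F.toPreFRM.fiber x) := isClosed_singleton.preimage F.proj_cont
      exact (closure_minimal (fun z hz => hz.1) hc) hy
    refine ⟨hyx, ?_⟩
    rintro ⟨-, r, hr, h⟩
    obtain ⟨z, hz, hzy⟩ := Metric.mem_closure_iff.1 hy (r / 2) (half_pos hr)
    apply hz.2
    have hsub : ball z (r / 2) ⊆ ball y r := by
      intro w hw
      rw [mem_ball] at hw ⊢
      rw [dist_comm] at hzy
      linarith [dist_triangle w z y]
    refine ⟨hz.1, r / 2, half_pos hr, fun ε hε => ?_⟩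
    obtain ⟨δ, hδ, h⟩ := h ε hε
    exact ⟨δ, hδ, fun n y₁ h1 y₂ h2 hd => h n y₁ ⟨h1.1, hsub h1.2⟩ y₂ ⟨h2.1, hsub h2.2⟩ hd⟩
  · intro x y hy
    obtain ⟨p, rfl⟩ := M.b_surj x
    obtain ⟨ζ₀, rfl⟩ := hex p y hy
    have hfr := M.not_isolated p ((hjul p ζ₀).1 hy)
    rw [accPt_iff_frequently]
    rw [frequently_nhdsWithin_iff] at hfr
    refine (M.par_cont1 p).continuousAt.frequently (hfr.mono ?_)
    rintro ζ ⟨h1, h2⟩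
    exact ⟨fun h => h2 (M.par_inj p h), (hjul p ζ).2 h1⟩
  · intro V hV
    rw [isOpen_iff_mem_nhds]
    rintro x ⟨y, hyV, hyJ⟩
    by_contra hcon
    have hne : (𝓝 x ⊓ 𝓟 {x | (V ∩ F.toPreFRM.julia x).Nonempty}ᶜ).NeBot := by
      rw [← frequently_mem_iff_neBot]
      intro hev
      exact hcon (hev.mono fun z hz => not_not.1 hz)
    set 𝒰 : Ultrafilter X := Ultrafilter.of (𝓝 x ⊓ 𝓟 {x | (V ∩ F.toPreFRM.julia x).Nonempty}ᶜ)
    have h𝒰 := Ultrafilter.of_le (𝓝 x ⊓ 𝓟 {x | (V ∩ F.toPreFRM.julia x).Nonempty}ᶜ)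
    have h𝒰1 : (𝒰 : Filter X) ≤ 𝓝 x := h𝒰.trans inf_le_left
    have h𝒰2 : ∀ᶠ x' in (𝒰 : Filter X), ¬ (V ∩ F.toPreFRM.julia x').Nonempty :=
      le_principal_iff.1 (h𝒰.trans inf_le_right)
    choose p hp using M.b_surj
    obtain ⟨p₀, -, hp₀⟩ := isCompact_univ.ultrafilter_le_nhds (𝒰.map p) (by simp)
    have htend : Tendsto p 𝒰 (𝓝 p₀) := hp₀
    have hb : M.b p₀ = x := by
      have h1 : Tendsto (fun x' => M.b (p x')) 𝒰 (𝓝 (M.b p₀)) :=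
        (M.b_cont.tendsto p₀).comp htend
      simp only [hp] at h1
      exact tendsto_nhds_unique h1 h𝒰1
    subst hb
    obtain ⟨ζ₀, rfl⟩ := hex p₀ y hyJ
    have hpre : (Function.uncurry M.par) ⁻¹' V ∈ 𝓝 (p₀, ζ₀) :=
      (hV.preimage M.par_cont).mem_nhds hyV
    rw [mem_nhds_prod_iff] at hpre
    obtain ⟨A, hA, N, hN, hAN⟩ := hpre
    refine (hjul p₀ ζ₀).1 hyJ (M.fat_limit 𝒰 htend hN ?_)
    filter_upwards [h𝒰2, htend hA] with x' h1 h2 ζ hζ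
    by_contra hnf
    apply h1
    have := (hjul (p x') ζ).2 hnf
    rw [hp] at this
    exact ⟨_, hAN (mk_mem_prod h2 hζ), this⟩

end build

end FJ

namespace FJ

section michael

variable {X E : Type*} [MetricSpace X] [NormedAddCommGroup E] [NormedSpace ℝ E]

lemma michael_step (K : X → Set E) (hc : ∀ x, Convex ℝ (K x))
    (hl : ∀ x, ∀ c ∈ K x, ∀ ε > (0:ℝ), ∀ᶠ x' in 𝓝 x, c ∈ thickening ε (K x'))
    (s : C(X, E)) {ε δ : ℝ} (hδ : 0 < δ) (hs : ∀ x, s x ∈ thickening ε (K x)) :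
    ∃ s' : C(X, E), ∀ x, s' x ∈ thickening δ (K x) ∩ ball (s x) ε := by
  refine exists_continuous_forall_mem_convex_of_local_const
    (t := fun x => thickening δ (K x) ∩ ball (s x) ε)
    (fun x => ((hc x).thickening δ).inter (convex_ball _ _)) fun x => ?_
  obtain ⟨c, hcK, hd⟩ := mem_thickening_iff.1 (hs x)
  refine ⟨c, (hl x c hcK δ hδ).and ?_⟩
  have : ContinuousAt (fun y => dist c (s y)) x := by fun_prop
  rw [dist_comm] at hd
  exact this.eventually (gt_mem_nhds hd)

lemma michael [CompleteSpace E] (K : X → Set E) (hc : ∀ x, Convex ℝ (K x))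
    (hcl : ∀ x, IsClosed (K x)) (hne : ∀ x, (K x).Nonempty)
    (hl : ∀ x, ∀ c ∈ K x, ∀ ε > (0:ℝ), ∀ᶠ x' in 𝓝 x, c ∈ thickening ε (K x')) :
    ∃ s : X → E, Continuous s ∧ ∀ x, s x ∈ K x := by
  obtain ⟨s₀, hs₀⟩ : ∃ s : C(X, E), ∀ x, s x ∈ thickening 1 (K x) :=
    exists_continuous_forall_mem_convex_of_local_const (t := fun x => thickening 1 (K x))
      (fun x => (hc x).thickening 1) fun x => by
        obtain ⟨c, h⟩ := hne x
        exact ⟨c, hl x c h 1 one_pos⟩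
  let T : ℕ → Type _ := fun n => {s : C(X, E) // ∀ x, s x ∈ thickening ((1:ℝ) / 2 / 2 ^ n * 2) (K x)}
  have step : ∀ n (s : T n), ∃ s' : T (n + 1), ∀ x, dist (s.1 x) (s'.1 x) ≤ (2:ℝ) / 2 / 2 ^ n := by
    intro n s
    obtain ⟨s', h⟩ := michael_step K hc hl s.1 (δ := (1:ℝ) / 2 / 2 ^ (n + 1) * 2) (by positivity) s.2
    refine ⟨⟨s', fun x => (h x).1⟩, fun x => ?_⟩
    have := (h x).2
    rw [mem_ball, dist_comm] at this
    refine this.le.trans (le_of_eq ?_)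
    ring
  choose nx hnx using step
  let S : ∀ n, T n := fun n => Nat.rec (⟨s₀, by simpa using hs₀⟩ : T 0) (fun n s => nx n s) n
  have hS : ∀ x n, dist ((S n).1 x) ((S (n + 1)).1 x) ≤ (2:ℝ) / 2 / 2 ^ n := fun x n => hnx n (S n) x
  have hlim : ∀ x, ∃ l, Tendsto (fun n => (S n).1 x) atTop (𝓝 l) := fun x =>
    cauchySeq_tendsto_of_complete (cauchySeq_of_le_geometric_two (hS x))
  choose l hlx using hlim
  have hb : ∀ x n, dist ((S n).1 x) (l x) ≤ 2 / 2 ^ n := fun x n =>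
    dist_le_of_le_geometric_two_of_tendsto (hS x) (hlx x) n
  have hz : Tendsto (fun n : ℕ => (2:ℝ) / 2 ^ n) atTop (𝓝 0) := by
    have := (tendsto_pow_atTop_nhds_zero_of_lt_one (r := (1:ℝ) / 2) (by norm_num) (by norm_num)).const_mul 2
    simpa [div_eq_mul_inv] using this
  refine ⟨l, ?_, fun x => ?_⟩
  · refine continuous_of_uniform_approx_of_continuous fun u hu => ?_
    obtain ⟨ε, hε, hu⟩ := Metric.mem_uniformity_dist.1 hu
    obtain ⟨n, hn⟩ := (hz.eventually (gt_mem_nhds hε)).exists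
    refine ⟨(S n).1, (S n).1.continuous, fun x => hu ?_⟩
    rw [dist_comm]
    exact (hb x n).trans_lt hn
  · rw [← (hcl x).closure_eq, Metric.mem_closure_iff]
    intro ε hε
    obtain ⟨n, hn⟩ := (hz.eventually (gt_mem_nhds (half_pos hε))).exists
    obtain ⟨c, hcK, hd⟩ := mem_thickening_iff.1 ((S n).2 x)
    refine ⟨c, hcK, ?_⟩
    have h1 := hb x n
    rw [dist_comm] at h1
    have h2 : (1:ℝ) / 2 / 2 ^ n * 2 ≤ 2 / 2 ^ n := by
      rw [div_mul_eq_mul_div]; gcongr; norm_num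
    linarith [dist_triangle (l x) ((S n).1 x) c]

lemma tsum_mem_convex [CompleteSpace E] {K : Set E} (hc : Convex ℝ K) (hcl : IsClosed K) {a : ℕ → E}
    (ha : ∀ n, a n ∈ K) {w : ℕ → ℝ} (hw : ∀ n, 0 ≤ w n) (hw1 : HasSum w 1) {e : E}
    (he : HasSum (fun n => w n • a n) e) : e ∈ K := by
  have h1 : Tendsto (fun N => ∑ n ∈ Finset.range N, w n • a n +
      (1 - ∑ n ∈ Finset.range N, w n) • a 0) atTop (𝓝 (e + (1 - 1 : ℝ) • a 0)) :=
    he.tendsto_sum_nat.add ((tendsto_const_nhds.sub hw1.tendsto_sum_nat).smul_const _)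
  rw [sub_self, zero_smul, add_zero] at h1
  refine hcl.mem_of_tendsto h1 (Eventually.of_forall fun N => ?_)
  have hle : ∑ n ∈ Finset.range N, w n ≤ 1 := sum_le_hasSum _ (fun n _ => hw n) hw1
  have := hc.sum_mem (t := Finset.range (N + 1))
    (w := fun n => if n = 0 then 1 - ∑ n ∈ Finset.range N, w n else w (n - 1))
    (z := fun n => if n = 0 then a 0 else a (n - 1)) (by
      intro i _
      split_ifs
      · linarith
      · exact hw _) (by
      rw [Finset.sum_range_succ']
      simp) (by
      intro i _
      split_ifs <;> exact ha _)
  rw [Finset.sum_range_succ'] at this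
  simpa using this

end michael

section meas

variable (Y : Type*) [MetricSpace Y]

def LB : Type _ := {f : Y → ℝ // LipschitzWith 1 f ∧ ∀ y, |f y| ≤ 1}

instance : TopologicalSpace (LB Y) := ⊥
instance : DiscreteTopology (LB Y) := ⟨rfl⟩

abbrev LBE := BoundedContinuousFunction (LB Y) ℝ

variable {Y}

noncomputable def lam (y : Y) : LBE Y :=
  BoundedContinuousFunction.ofNormedAddCommGroupDiscrete (fun f : LB Y => f.1 y) 1 fun f => f.2.2 y

lemma lam_apply (y : Y) (f : LB Y) : lam y f = f.1 y := rfl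

lemma lam_dist (y z : Y) : dist (lam y) (lam z) ≤ dist y z := by
  rw [BoundedContinuousFunction.dist_le dist_nonneg]
  intro f
  have := f.2.1.dist_le_mul y z
  rw [NNReal.coe_one, one_mul] at this
  exact this

variable [CompactSpace Y] [MeasurableSpace Y] [BorelSpace Y]

def Repr (J : Set Y) : Set (LBE Y) :=
  {e | ∃ μ : ProbabilityMeasure Y, (μ : Measure Y) Jᶜ = 0 ∧ ∀ f : LB Y, e f = ∫ y, f.1 y ∂(μ : Measure Y)}

lemma lb_int (f : LB Y) (μ : Measure Y) [IsFiniteMeasure μ] : Integrable f.1 μ :=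
  Integrable.of_bound f.2.1.continuous.aestronglyMeasurable 1 (Eventually.of_forall f.2.2)

lemma repr_convex (J : Set Y) : Convex ℝ (Repr J) := by
  rintro e ⟨μ, hμ, he⟩ e' ⟨ν, hν, he'⟩ a b ha hb hab
  have hp : IsProbabilityMeasure (ENNReal.ofReal a • (μ : Measure Y) + ENNReal.ofReal b • (ν : Measure Y)) := by
    constructor
    simp [← ENNReal.ofReal_add ha hb, hab]
  refine ⟨⟨_, hp⟩, ?_, fun f => ?_⟩
  · simp [hμ, hν]
  · show _ = ∫ y, f.1 y ∂(ENNReal.ofReal a • (μ : Measure Y) + ENNReal.ofReal b • (ν : Measure Y))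
    rw [integral_add_measure ((lb_int f _).smul_measure ENNReal.ofReal_ne_top)
      ((lb_int f _).smul_measure ENNReal.ofReal_ne_top), integral_smul_measure, integral_smul_measure,
      ENNReal.toReal_ofReal ha, ENNReal.toReal_ofReal hb, ← he, ← he']
    rfl

noncomputable def lbDist (J : Set Y) : LB Y := ⟨fun y => min 1 (infDist y J), by
    exact (lipschitz_infDist_pt J).const_min 1, fun y => by
    rw [abs_of_nonneg (le_min zero_le_one infDist_nonneg)]
    exact min_le_left _ _⟩

lemma lbDist_nonneg (J : Set Y) (y : Y) : 0 ≤ (lbDist J).1 y := le_min zero_le_one infDist_nonneg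

lemma repr_closed {J : Set Y} (hJ : IsClosed J) (hne : J.Nonempty) : IsClosed (Repr J) := by
  rw [isClosed_iff_ultrafilter]
  intro e u hu hR
  have hR' : ∀ᶠ e' in (u : Filter (LBE Y)), e' ∈ Repr J := hR
  have : ∀ e' : LBE Y, ∃ μ : ProbabilityMeasure Y, e' ∈ Repr J → ((μ : Measure Y) Jᶜ = 0 ∧
      ∀ f : LB Y, e' f = ∫ y, f.1 y ∂(μ : Measure Y)) := by
    intro e'
    by_cases h : e' ∈ Repr J
    · obtain ⟨μ, h⟩ := h
      exact ⟨μ, fun _ => h⟩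
    · obtain ⟨y, -⟩ := hne
      exact ⟨⟨Measure.dirac y, inferInstance⟩, fun h' => absurd h' h⟩
  choose m hm using this
  obtain ⟨μ, -, hμ⟩ := isCompact_univ.ultrafilter_le_nhds (u.map m) (by simp)
  have htend : Tendsto m u (𝓝 μ) := hμ
  rw [ProbabilityMeasure.tendsto_iff_forall_integral_tendsto] at htend
  have hf : ∀ f : LB Y, e f = ∫ y, f.1 y ∂(μ : Measure Y) := by
    intro f
    have h1 := htend (BoundedContinuousFunction.ofNormedAddCommGroup f.1 f.2.1.continuous 1 f.2.2)
    have h2 : Tendsto (fun e' : LBE Y => e' f) u (𝓝 (e f)) :=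
      ((continuous_eval_const f).tendsto e).mono_left hu
    refine tendsto_nhds_unique h2 (h1.congr' ?_)
    filter_upwards [hR'] with e' he'
    exact ((hm e' he').2 f).symm
  refine ⟨μ, ?_, hf⟩
  have h0 : e (lbDist J) = 0 := by
    have h2 : Tendsto (fun e' : LBE Y => e' (lbDist J)) u (𝓝 (e (lbDist J))) :=
      ((continuous_eval_const (lbDist J)).tendsto e).mono_left hu
    refine tendsto_nhds_unique h2 (tendsto_const_nhds.congr' ?_)
    filter_upwards [hR'] with e' he'
    obtain ⟨h3, h4⟩ := hm e' he'
    rw [h4]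
    symm
    refine integral_eq_zero_of_ae ?_
    have : ∀ᵐ y ∂(m e' : Measure Y), y ∈ J := h3
    filter_upwards [this] with y hy
    show min 1 (infDist y J) = 0
    rw [infDist_zero_of_mem hy]; simp
  rw [hf, integral_eq_zero_iff_of_nonneg (lbDist_nonneg J) (lb_int _ _)] at h0
  have h5 : ∀ᵐ y ∂(μ : Measure Y), y ∈ J := by
    filter_upwards [h0] with y hy
    rw [hJ.mem_iff_infDist_zero hne]
    have hy' : min 1 (infDist y J) = 0 := hy
    rcases min_choice 1 (infDist y J) with h | h
    · rw [h] at hy'; norm_num at hy'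
    · rw [h] at hy'; exact hy'
  exact h5

def KK (J : Set Y) : Set (LBE Y) := closure (convexHull ℝ (lam '' J))

lemma KK_sub {J : Set Y} (hJ : IsClosed J) (hne : J.Nonempty) : KK J ⊆ Repr J := by
  refine closure_minimal (convexHull_min ?_ (repr_convex J)) (repr_closed hJ hne)
  rintro _ ⟨y, hy, rfl⟩
  refine ⟨⟨Measure.dirac y, inferInstance⟩, ?_, fun f => ?_⟩
  · show Measure.dirac y Jᶜ = 0
    rw [Measure.dirac_apply' _ hJ.measurableSet.compl]
    simp [hy]
  · show _ = ∫ z, f.1 z ∂(Measure.dirac y)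
    rw [integral_dirac]; rfl

lemma KK_mono {J J' : Set Y} (h : J ⊆ J') : KK J ⊆ KK J' :=
  closure_mono (convexHull_mono (image_mono h))

variable {X : Type*} [MetricSpace X]

lemma KK_lsc {J : X → Set Y} (hl : ∀ V : Set Y, IsOpen V → IsOpen {x | (V ∩ J x).Nonempty}) (x : X)
    (c : LBE Y) (hc : c ∈ KK (J x)) (ε : ℝ) (hε : 0 < ε) :
    ∀ᶠ x' in 𝓝 x, c ∈ thickening ε (KK (J x')) := by
  have key : ∀ c ∈ convexHull ℝ (lam '' (J x)), ∀ᶠ x' in 𝓝 x,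
      c ∈ thickening (ε / 2) (convexHull ℝ (lam '' (J x'))) := by
    have hconv : Convex ℝ {c : LBE Y | ∀ᶠ x' in 𝓝 x,
        c ∈ thickening (ε / 2) (convexHull ℝ (lam '' (J x')))} := by
      intro c h1 c' h2 a b ha hb hab
      have h1' : ∀ᶠ x' in 𝓝 x, c ∈ thickening (ε / 2) (convexHull ℝ (lam '' (J x'))) := h1
      have h2' : ∀ᶠ x' in 𝓝 x, c' ∈ thickening (ε / 2) (convexHull ℝ (lam '' (J x'))) := h2
      show ∀ᶠ x' in 𝓝 x, _
      filter_upwards [h1', h2'] with x' h3 h4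
      exact ((convex_convexHull ℝ _).thickening _) h3 h4 ha hb hab
    refine convexHull_min ?_ hconv
    rintro _ ⟨y, hy, rfl⟩
    have := (hl (ball y (ε / 2)) isOpen_ball).mem_nhds ⟨y, mem_ball_self (half_pos hε), hy⟩
    show ∀ᶠ x' in 𝓝 x, _
    filter_upwards [this] with x' hx'
    obtain ⟨y', h1, h2⟩ := hx'
    rw [mem_thickening_iff]
    refine ⟨lam y', subset_convexHull ℝ _ (mem_image_of_mem _ h2), ?_⟩
    rw [mem_ball, dist_comm] at h1
    exact (lam_dist _ _).trans_lt h1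
  obtain ⟨c', hc', hd⟩ := Metric.mem_closure_iff.1 hc (ε / 2) (half_pos hε)
  filter_upwards [key c' hc'] with x' hx'
  obtain ⟨e, he, hd'⟩ := mem_thickening_iff.1 hx'
  refine mem_thickening_iff.2 ⟨e, subset_closure he, ?_⟩
  linarith [dist_triangle c c' e]

lemma exists_sel {J : X → Set Y} (hne : ∀ x, (J x).Nonempty)
    (hl : ∀ V : Set Y, IsOpen V → IsOpen {x | (V ∩ J x).Nonempty}) :
    ∃ s : X → LBE Y, Continuous s ∧ ∀ x, s x ∈ KK (J x) :=
  michael (fun x => KK (J x)) (fun x => (convex_convexHull ℝ _).closure) (fun x => isClosed_closure)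
    (fun x => by
      obtain ⟨y, hy⟩ := hne x
      exact ⟨lam y, subset_closure (subset_convexHull ℝ _ (mem_image_of_mem _ hy))⟩)
    (fun x c hc ε hε => KK_lsc hl x c hc ε hε)

lemma exists_seq_basis (Z : Type*) [MetricSpace Z] [CompactSpace Z] :
    ∃ V : ℕ → Set Z, (∀ n, IsOpen (V n)) ∧
      ∀ (z : Z) (W : Set Z), IsOpen W → z ∈ W → ∃ n, z ∈ V n ∧ closure (V n) ⊆ W := by
  have hB := TopologicalSpace.isBasis_countableBasis Z
  obtain ⟨V, hV⟩ := ((TopologicalSpace.countable_countableBasis Z).insert univ).exists_eq_range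
    (insert_nonempty _ _)
  refine ⟨V, fun n => ?_, fun z W hW hz => ?_⟩
  · have : V n ∈ insert univ (TopologicalSpace.countableBasis Z) := by
      rw [hV]; exact mem_range_self n
    rcases this with h | h
    · rw [h]; exact isOpen_univ
    · exact hB.isOpen h
  · obtain ⟨t, ht, hzt, hcl⟩ := hB.exists_closure_subset (hW.mem_nhds hz)
    have : t ∈ insert univ (TopologicalSpace.countableBasis Z) := Or.inr ht
    rw [hV] at this
    obtain ⟨n, rfl⟩ := this
    exact ⟨n, hzt, hcl⟩

lemma exists_meas [CompactSpace X] {J : X → Set Y} (hne : ∀ x, (J x).Nonempty)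
    (hcl : ∀ x, IsClosed (J x))
    (hl : ∀ V : Set Y, IsOpen V → IsOpen {x | (V ∩ J x).Nonempty}) :
    ∃ μ : X → ProbabilityMeasure Y, Continuous μ ∧ ∀ x, ∀ V : Set Y, IsOpen V →
      ((μ x : Measure Y) V ≠ 0 ↔ (V ∩ J x).Nonempty) := by
  classical
  obtain ⟨V, hVo, hVb⟩ := exists_seq_basis Y
  obtain ⟨W, hWo, hWb⟩ := exists_seq_basis X
  -- the individual selections
  have hsel : ∀ k l : ℕ, ∃ s : X → LBE Y, Continuous s ∧ (∀ x, s x ∈ KK (J x)) ∧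
      ((closure (W l) ⊆ {x | (V k ∩ J x).Nonempty}) → ∀ x ∈ closure (W l),
        s x ∈ KK (closure (V k ∩ J x))) := by
    intro k l
    by_cases hkl : closure (W l) ⊆ {x | (V k ∩ J x).Nonempty}
    · set J' : X → Set Y := fun x => if x ∈ closure (W l) then closure (V k ∩ J x) else J x with hJ'
      have hsub : ∀ x, J' x ⊆ J x := by
        intro x
        by_cases hx : x ∈ closure (W l)
        · simp only [hJ', if_pos hx]
          exact closure_minimal inter_subset_right (hcl x)
        · simp only [hJ', if_neg hx]
          exact subset_rfl
      obtain ⟨s, hs, hsK⟩ := exists_sel (J := J') (by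
        intro x
        by_cases hx : x ∈ closure (W l)
        · simp only [hJ', if_pos hx]
          exact (hkl hx).closure
        · simp only [hJ', if_neg hx]
          exact hne x) (by
        intro U hU
        rw [isOpen_iff_mem_nhds]
        intro x hx
        by_cases hxc : x ∈ closure (W l)
        · have hx' : (U ∩ closure (V k ∩ J x)).Nonempty := by
            have h0 : (U ∩ J' x).Nonempty := hx
            simpa only [hJ', if_pos hxc] using h0
          have hx2 : ((U ∩ V k) ∩ J x).Nonempty := by
            obtain ⟨y, hyU, hy⟩ := hx'
            obtain ⟨z, hz1, hz2⟩ := mem_closure_iff.1 hy U hU hyU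
            exact ⟨z, ⟨hz1, hz2.1⟩, hz2.2⟩
          filter_upwards [(hl _ (hU.inter (hVo k))).mem_nhds hx2] with x' h
          obtain ⟨y, ⟨h1, h2⟩, h3⟩ := h
          refine ⟨y, h1, ?_⟩
          by_cases hx'c : x' ∈ closure (W l)
          · simp only [hJ', if_pos hx'c]
            exact subset_closure ⟨h2, h3⟩
          · simp only [hJ', if_neg hx'c]
            exact h3
        · have hx' : (U ∩ J x).Nonempty := by
            have h0 : (U ∩ J' x).Nonempty := hx
            simpa only [hJ', if_neg hxc] using h0
          filter_upwards [(hl _ hU).mem_nhds hx', isClosed_closure.isOpen_compl.mem_nhds hxc]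
            with x' h h2
          show (U ∩ J' x').Nonempty
          simp only [hJ', if_neg h2]
          exact h)
      refine ⟨s, hs, fun x => KK_mono (hsub x) (hsK x), fun _ x hx => ?_⟩
      have := hsK x
      simpa only [hJ', if_pos hx] using this
    · obtain ⟨s, hs, hsK⟩ := exists_sel hne hl
      exact ⟨s, hs, hsK, fun h => absurd h hkl⟩
  choose s hsc hsK hsV using hsel
  let a : ℕ → X → LBE Y := fun n => s n.unpair.1 n.unpair.2
  let w : ℕ → ℝ := fun n => 1 / 2 / 2 ^ n
  have hw0 : ∀ n, 0 < w n := fun n => by positivity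
  have hw1 : HasSum w 1 := hasSum_geometric_two' 1
  have hnorm : ∀ n x, ‖a n x‖ ≤ 1 := by
    intro n x
    obtain ⟨μ, -, h⟩ := KK_sub (hcl x) (hne x) (hsK n.unpair.1 n.unpair.2 x)
    rw [BoundedContinuousFunction.norm_le zero_le_one]
    intro f
    rw [h f]
    refine (norm_integral_le_of_norm_le_const (Eventually.of_forall f.2.2)).trans ?_
    simp
  have hbd : ∀ n x, ‖w n • a n x‖ ≤ w n := by
    intro n x
    rw [norm_smul, Real.norm_of_nonneg (hw0 n).le]
    exact mul_le_of_le_one_right (hw0 n).le (hnorm n x)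
  let σ : X → LBE Y := fun x => ∑' n, w n • a n x
  have hσc : Continuous σ :=
    continuous_tsum (fun n => (hsc n.unpair.1 n.unpair.2).const_smul (w n)) hw1.summable hbd
  have hσs : ∀ x, HasSum (fun n => w n • a n x) (σ x) := fun x =>
    (Summable.of_norm_bounded hw1.summable (fun n => hbd n x)).hasSum
  have hσK : ∀ x, σ x ∈ KK (J x) := fun x =>
    tsum_mem_convex (convex_convexHull ℝ _).closure isClosed_closure
      (fun n => hsK n.unpair.1 n.unpair.2 x) (fun n => (hw0 n).le) hw1 (hσs x)
  have hrep : ∀ x, σ x ∈ Repr (J x) := fun x => KK_sub (hcl x) (hne x) (hσK x)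
  choose μ hμ0 hμf using hrep
  refine ⟨μ, ?_, fun x U hU => ⟨fun h => ?_, fun h => ?_⟩⟩
  · rw [continuous_iff_continuousAt]
    intro x
    refine tendsto_iff_forall_lipschitz_integral_tendsto.2 ?_
    rintro f - ⟨L, hL⟩
    obtain ⟨C, hC⟩ := (isCompact_univ (X := Y)).exists_bound_of_continuousOn hL.continuous.continuousOn
    set R : ℝ := max 1 (max C L) with hR
    have hR0 : 0 < R := lt_of_lt_of_le one_pos (le_max_left _ _)
    have hRC : C ≤ R := (le_max_left _ _).trans (le_max_right _ _)
    have hRL : (L:ℝ) ≤ R := (le_max_right _ _).trans (le_max_right _ _)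
    let f' : LB Y := ⟨fun y => R⁻¹ * f y, by
      refine LipschitzWith.of_dist_le_mul fun y z => ?_
      rw [Real.dist_eq, ← mul_sub, abs_mul, abs_of_pos (inv_pos.2 hR0), NNReal.coe_one, one_mul,
        ← Real.dist_eq, inv_mul_le_iff₀ hR0]
      exact (hL.dist_le_mul y z).trans (by gcongr), fun y => by
      rw [abs_mul, abs_of_pos (inv_pos.2 hR0), inv_mul_le_iff₀ hR0, mul_one]
      exact (hC y (mem_univ y)).trans hRC⟩
    have hi : ∀ x', ∫ y, f y ∂(μ x' : Measure Y) = R * σ x' f' := by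
      intro x'
      rw [hμf x' f', ← integral_const_mul]
      congr 1
      funext y
      show f y = R * (R⁻¹ * f y)
      field_simp
    simp only [hi]
    exact (((continuous_eval_const f').comp hσc).const_mul R).continuousAt
  · by_contra hcon
    apply h
    refine measure_mono_null (fun y hy hyJ => hcon ⟨y, hy, hyJ⟩) (hμ0 x)
  · obtain ⟨y, hyU, hyJ⟩ := h
    rcases Uᶜ.eq_empty_or_nonempty with hUe | hUne
    · have : U = univ := compl_empty_iff.1 hUe
      rw [this]; simp
    intro hzero
    have hpos : ∀ z, z ∈ U → 0 < (lbDist Uᶜ).1 z := by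
      intro z hz
      refine lt_min one_pos ?_
      exact (hU.isClosed_compl.notMem_iff_infDist_pos hUne).1 (fun h => h hz)
    have hz0 : ∀ z, z ∉ U → (lbDist Uᶜ).1 z = 0 := by
      intro z hz
      show min 1 (infDist z Uᶜ) = 0
      rw [infDist_zero_of_mem hz]; simp
    have h1 : σ x (lbDist Uᶜ) = 0 := by
      rw [hμf]
      refine integral_eq_zero_of_ae ?_
      have : ∀ᵐ z ∂(μ x : Measure Y), z ∉ U := by
        rw [ae_iff]; simpa using hzero
      filter_upwards [this] with z hz
      exact hz0 z hz
    obtain ⟨k, hyk, hk⟩ := hVb y U hU hyU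
    obtain ⟨l, hxl, hl'⟩ := hWb x _ (hl _ (hVo k)) ⟨y, hyk, hyJ⟩
    have hsum : HasSum (fun n => w n * a n x (lbDist Uᶜ)) (σ x (lbDist Uᶜ)) :=
      (hσs x).map (BoundedContinuousFunction.evalCLM ℝ (lbDist Uᶜ))
        (BoundedContinuousFunction.evalCLM ℝ (lbDist Uᶜ)).continuous
    have hnn : ∀ n, 0 ≤ a n x (lbDist Uᶜ) := by
      intro n
      obtain ⟨m, -, h⟩ := KK_sub (hcl x) (hne x) (hsK n.unpair.1 n.unpair.2 x)
      rw [show a n x (lbDist Uᶜ) = _ from h _]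
      exact integral_nonneg (lbDist_nonneg _)
    have hle := le_hasSum hsum (Nat.pair k l) (fun n _ => mul_nonneg (hw0 n).le (hnn n))
    rw [h1] at hle
    have hal : a (Nat.pair k l) x = s k l x := by simp only [a, Nat.unpair_pair]
    rw [hal] at hle
    have hgt : 0 < s k l x (lbDist Uᶜ) := by
      obtain ⟨m, hm, h⟩ := KK_sub isClosed_closure 
        (show (V k ∩ J x).Nonempty from ⟨y, hyk, hyJ⟩).closure
        (hsV k l hl' x (subset_closure hxl))
      rw [h, integral_pos_iff_support_of_nonneg (lbDist_nonneg _) (lb_int _ _)]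
      have hsub : (closure (V k ∩ J x))ᶜᶜ ⊆ Function.support (lbDist Uᶜ).1 := by
        rw [compl_compl]
        intro z hz
        exact (hpos z (hk (closure_mono inter_subset_left hz))).ne'
      refine lt_of_lt_of_le ?_ (measure_mono hsub)
      rw [prob_compl_eq_one_sub isClosed_closure.measurableSet.compl, hm]
      simp
    have := mul_pos (hw0 (Nat.pair k l)) hgt
    linarith

end meas

end FJ

/-- **Proposition (Sumi, Prop 2.3; potential theory)**.
Let `(π, Y, X)` be a `ℂ̂`-bundle and `f : Y → Y` a fibered rational map over
`g : X → X` with `d(x) ≥ 2` for each `x`.  Then there is a family of Borel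
probability measures `μ_x` on `Y`, continuous in `x` for the weak topology,
with `supp μ_x = J_x` for each `x`; consequently `x ↦ J_x` is lower
semicontinuous; moreover each `J_x` is a non-empty perfect set. -/
theorem exists_measures_supported_on_fiberwise_julia_sets
    {X Y : Type} [MetricSpace X] [MetricSpace Y] [CompactSpace X] [CompactSpace Y]
    [MeasurableSpace Y] [BorelSpace Y]
    (F : FRM X Y) (hdeg : ∀ x : X, F.toPreFRM.degGe x 2) :
    (∃ μ : X → MeasureTheory.ProbabilityMeasure Y, Continuous μ ∧
      ∀ x : X, ∀ V : Set Y, IsOpen V →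
        ((μ x : MeasureTheory.Measure Y) V ≠ 0 ↔ (V ∩ F.toPreFRM.julia x).Nonempty)) ∧
    (∀ (x : X) (xs : ℕ → X), Filter.Tendsto xs Filter.atTop (𝓝 x) →
      ∀ y ∈ F.toPreFRM.julia x, ∃ ys : ℕ → Y,
        (∀ n, ys n ∈ F.toPreFRM.julia (xs n)) ∧
        Filter.Tendsto ys Filter.atTop (𝓝 y)) ∧
    (∀ x : X, (F.toPreFRM.julia x).Nonempty ∧ Perfect (F.toPreFRM.julia x)) := by
  obtain ⟨hne, hcl, hpp, hl⟩ := FJ.julia_facts F hdeg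
  refine ⟨FJ.exists_meas hne hcl hl, ?_, fun x => ⟨hne x, ⟨hcl x, hpp x⟩⟩⟩
  intro x xs hxs y hy
  have h1 : ∀ n, ∃ z ∈ F.toPreFRM.julia (xs n),
      Metric.infDist y (F.toPreFRM.julia (xs n)) = dist y z := fun n =>
    (hcl (xs n)).isCompact.exists_infDist_eq_dist (hne _) y
  choose ys hys hd using h1
  refine ⟨ys, hys, ?_⟩
  rw [Metric.tendsto_atTop']
  intro ε hε
  have h2 := hxs.eventually ((hl (Metric.ball y ε) Metric.isOpen_ball).mem_nhds
    ⟨y, Metric.mem_ball_self hε, hy⟩)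
  obtain ⟨N, hN⟩ := Filter.eventually_atTop.1 h2
  refine ⟨N, fun n hn => ?_⟩
  obtain ⟨z, hz1, hz2⟩ := hN n hn.le
  rw [dist_comm, ← hd n]
  refine (Metric.infDist_le_dist_of_mem hz2).trans_lt ?_
  rw [dist_comm]
  exact hz1
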